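/- arXiv:1810.10846 — 3 statements merged into one kernel-verified Lean document; each statement's English description precedes it below -/
import Mathlib

section
/- For any finite set A of positive real numbers, |A/A + A| ≫ |A|^{3/2 + 1/26} / (log |A|)^{5/6}. That is, there exists an absolute constant c > 0 such that for every finite set A of positive reals with |A| ≥ 2, |{a/b + c : a,b,c ∈ A}| ≥ c·|A|^{40/26} / (log |A|)^{5/6}. -/
open Finset

lemma card_le_image_add {α β : Type*} [DecidableEq α] [DecidableEq β] (s : Finset α) (f : α → β) :
    #s ≤ #(s.image f) + #{p ∈ s ×ˢ s | p.1 ≠ p.2 ∧ f p.1 = f p.2} := by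
  induction s using Finset.induction_on with
  | empty => simp
  | insert a s ha ih =>
    rw [card_insert_of_notMem ha]
    have hmono : ({p ∈ s ×ˢ s | p.1 ≠ p.2 ∧ f p.1 = f p.2} : Finset (α × α)) ⊆
        {p ∈ (insert a s) ×ˢ (insert a s) | p.1 ≠ p.2 ∧ f p.1 = f p.2} := by
      apply filter_subset_filter
      exact product_subset_product (subset_insert _ _) (subset_insert _ _)
    by_cases h : f a ∈ s.image f
    · obtain ⟨b, hb, hab⟩ := mem_image.1 h
      have : insert (a, b) ({p ∈ s ×ˢ s | p.1 ≠ p.2 ∧ f p.1 = f p.2} : Finset (α × α)) ⊆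
        {p ∈ (insert a s) ×ˢ (insert a s) | p.1 ≠ p.2 ∧ f p.1 = f p.2} := by
        apply insert_subset _ hmono
        simp only [mem_filter, mem_product, mem_insert_self, true_and]
        exact ⟨mem_insert_of_mem hb, fun h => ha (h ▸ hb), hab.symm⟩
      have h2 := card_le_card this
      rw [card_insert_of_notMem (by simp [ha])] at h2
      have h3 : #(s.image f) ≤ #((insert a s).image f) :=
        card_le_card (image_subset_image (subset_insert _ _))
      omega
    · have h2 := card_le_card hmono
      rw [image_insert, card_insert_of_notMem h]
      omega

lemma cs_card {α β : Type*} [DecidableEq α] [DecidableEq β] (T : Finset α) (φ : α → β) :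
    #T ^ 2 ≤ #(T.image φ) * #{p ∈ T ×ˢ T | φ p.1 = φ p.2} := by
  have h1 := card_eq_sum_card_image φ T
  have h2 : #{p ∈ T ×ˢ T | φ p.1 = φ p.2} = ∑ b ∈ T.image φ, #{a ∈ T | φ a = b} ^ 2 := by
    rw [card_eq_sum_card_fiberwise (f := fun p : α × α => φ p.1) (t := T.image φ)]
    · apply sum_congr rfl
      intro b hb
      rw [sq, ← card_product]
      congr 1
      ext ⟨x, y⟩
      simp only [mem_filter, mem_product]
      constructor
      · rintro ⟨⟨⟨h1, h2⟩, h3⟩, h4⟩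
        exact ⟨⟨h1, h4⟩, h2, h3 ▸ h4⟩
      · rintro ⟨⟨h1, h2⟩, h3, h4⟩
        exact ⟨⟨⟨h1, h3⟩, h2.trans h4.symm⟩, h2⟩
    · intro p hp
      simp only [coe_filter, mem_product, Set.mem_ofPred_eq] at hp
      exact mem_coe.2 (mem_image_of_mem _ hp.1.1)
  rw [h1, h2]
  exact sq_sum_le_card_mul_sum_sq

noncomputable def rk (A : Finset ℝ) (x : ℝ) : ℕ := #{a ∈ A | a < x}

lemma rk_mono (A : Finset ℝ) {x y : ℝ} (h : x ≤ y) : rk A x ≤ rk A y := by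
  apply card_le_card
  intro a ha
  simp only [mem_filter] at ha ⊢
  exact ⟨ha.1, ha.2.trans_le h⟩

lemma rk_lt (A : Finset ℝ) {x y : ℝ} (hx : x ∈ A) (h : x < y) : rk A x < rk A y := by
  apply card_lt_card
  rw [ssubset_iff_of_subset]
  · exact ⟨x, by simp [hx, h], by simp⟩
  · intro a ha
    simp only [mem_filter] at ha ⊢
    exact ⟨ha.1, ha.2.trans h⟩

lemma rk_le (A : Finset ℝ) (x : ℝ) : rk A x ≤ #A := card_filter_le _ _

lemma rk_fiber (A : Finset ℝ) (h v : ℕ) (hh : 0 < h) : #{a ∈ A | rk A a / h = v} ≤ h := by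
  have : #{a ∈ A | rk A a / h = v} ≤ #(Finset.Ico (v * h) (v * h + h)) := by
    apply card_le_card_of_injOn (rk A)
    · intro a ha
      simp only [coe_filter, Set.mem_ofPred_eq] at ha
      simp only [coe_Ico, Set.mem_Ico]
      have := ha.2
      rw [Nat.div_eq_iff hh] at this
      omega
    · intro a ha b hb hab
      simp only [coe_filter, Set.mem_ofPred_eq] at ha hb
      rcases lt_trichotomy a b with h | h | h
      · exact absurd hab (rk_lt A ha.1 h).ne
      · exact h
      · exact absurd hab (rk_lt A hb.1 h).ne'
  simpa using this

lemma st_core (A B : Finset ℝ) (L : Finset (ℝ × ℝ)) (a b : ℕ) (ha : 0 < a) (hb : 0 < b) :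
    #{p ∈ L ×ˢ A | p.1.1 * p.2 + p.1.2 ∈ B} ≤
      #L * (#A / a + #B / b + 1) + #A * #B * (a * b) := by
  set f : ℝ → ℕ := fun x => rk A x / a with hf
  set g : ℝ → ℕ := fun x => rk B x / b with hg
  have fmono : ∀ x y, x ≤ y → f x ≤ f y := fun x y h => Nat.div_le_div_right (rk_mono A h)
  have gmono : ∀ x y, x ≤ y → g x ≤ g y := fun x y h => Nat.div_le_div_right (rk_mono B h)
  have fle : ∀ x, f x ≤ #A / a := fun x => Nat.div_le_div_right (rk_le A x)
  have gle : ∀ x, g x ≤ #B / b := fun x => Nat.div_le_div_right (rk_le B x)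
  set D : ℝ × ℝ → Finset (ℝ × ℝ) := fun l =>
    {p ∈ ({x ∈ A | l.1 * x + l.2 ∈ B} : Finset ℝ) ×ˢ ({x ∈ A | l.1 * x + l.2 ∈ B} : Finset ℝ) |
      p.1 ≠ p.2 ∧ (f p.1, g (l.1 * p.1 + l.2)) = (f p.2, g (l.1 * p.2 + l.2))} with hD
  have key : ∀ l ∈ L, #{x ∈ A | l.1 * x + l.2 ∈ B} ≤ (#A / a + #B / b + 1) + #(D l) := by
    intro l _
    refine (card_le_image_add {x ∈ A | l.1 * x + l.2 ∈ B}
      (fun x => (f x, g (l.1 * x + l.2)))).trans ?_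
    refine Nat.add_le_add_right ?_ _
    rw [← card_range (#A / a + #B / b + 1)]
    rcases le_total 0 l.1 with hl | hl
    · apply card_le_card_of_injOn (fun k : ℕ × ℕ => k.1 + k.2)
      · intro k hk
        simp only [coe_image, Set.mem_image] at hk
        obtain ⟨x, _, rfl⟩ := hk
        have := fle x
        have := gle (l.1 * x + l.2)
        simp only [coe_range, Set.mem_Iio]
        omega
      · intro k hk k' hk' hkk
        simp only [coe_image, Set.mem_image] at hk hk'
        obtain ⟨x, _, rfl⟩ := hk
        obtain ⟨y, _, rfl⟩ := hk'
        simp only at hkk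
        rcases le_total x y with h | h
        · have h1 := fmono _ _ h
          have h2 := gmono (l.1 * x + l.2) (l.1 * y + l.2) (by nlinarith)
          ext <;> simp only <;> omega
        · have h1 := fmono _ _ h
          have h2 := gmono (l.1 * y + l.2) (l.1 * x + l.2) (by nlinarith)
          ext <;> simp only <;> omega
    · apply card_le_card_of_injOn (fun k : ℕ × ℕ => k.1 + (#B / b - k.2))
      · intro k hk
        simp only [coe_image, Set.mem_image] at hk
        obtain ⟨x, _, rfl⟩ := hk
        have := fle x
        have := gle (l.1 * x + l.2)
        simp only [coe_range, Set.mem_Iio]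
        omega
      · intro k hk k' hk' hkk
        simp only [coe_image, Set.mem_image] at hk hk'
        obtain ⟨x, _, rfl⟩ := hk
        obtain ⟨y, _, rfl⟩ := hk'
        simp only at hkk
        have := gle (l.1 * x + l.2)
        have := gle (l.1 * y + l.2)
        rcases le_total x y with h | h
        · have h1 := fmono _ _ h
          have h2 := gmono (l.1 * y + l.2) (l.1 * x + l.2) (by nlinarith)
          ext <;> simp only <;> omega
        · have h1 := fmono _ _ h
          have h2 := gmono (l.1 * x + l.2) (l.1 * y + l.2) (by nlinarith)
          ext <;> simp only <;> omega
  have hI : #{p ∈ L ×ˢ A | p.1.1 * p.2 + p.1.2 ∈ B} =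
      ∑ l ∈ L, #{x ∈ A | l.1 * x + l.2 ∈ B} := by
    rw [card_filter, sum_product]
    apply sum_congr rfl
    intro l _
    rw [card_filter]
  have hDsum : ∑ l ∈ L, #(D l) ≤ #A * #B * (a * b) := by
    rw [← card_sigma]
    set E : Finset ((ℝ × ℝ) × (ℝ × ℝ)) :=
      {q ∈ (A ×ˢ B) ×ˢ (A ×ˢ B) | f q.2.1 = f q.1.1 ∧ g q.2.2 = g q.1.2} with hE
    have h1 : #(L.sigma D) ≤ #E := by
      apply card_le_card_of_injOn (fun s => ((s.2.1, s.1.1 * s.2.1 + s.1.2),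
        (s.2.2, s.1.1 * s.2.2 + s.1.2)))
      · rintro ⟨l, x, y⟩ hs
        simp only [hD, coe_sigma, Set.mem_sigma_iff, mem_coe, mem_filter, mem_product,
          Prod.mk.injEq] at hs
        simp only [hE, coe_filter, mem_product, Set.mem_ofPred_eq]
        obtain ⟨_, ⟨⟨h1, h2⟩, h3, h4⟩, _, h5, h6⟩ := hs
        exact ⟨⟨⟨h1, h2⟩, h3, h4⟩, h5.symm, h6.symm⟩
      · rintro ⟨⟨m, c⟩, x, y⟩ hs ⟨⟨m', c'⟩, x', y'⟩ hs' h
        simp only [hD, coe_sigma, Set.mem_sigma_iff, mem_coe, mem_filter, mem_product,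
          Prod.mk.injEq] at hs hs'
        simp only [Prod.mk.injEq] at h
        obtain ⟨⟨rfl, h1⟩, rfl, h2⟩ := h
        have hne := hs.2.2.1
        have hm : m = m' := by
          have : (m - m') * (x - y) = 0 := by linarith
          rcases mul_eq_zero.1 this with h | h
          · linarith
          · exact absurd (by linarith) hne
        subst hm
        have hc : c = c' := by linarith
        subst hc
        rfl
    refine h1.trans ?_
    have : E = (A ×ˢ B).biUnion (fun p => ({p} : Finset (ℝ × ℝ)) ×ˢ
        (({x ∈ A | f x = f p.1} : Finset ℝ) ×ˢ ({y ∈ B | g y = g p.2} : Finset ℝ))) := by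
      ext ⟨⟨x, y⟩, x', y'⟩
      simp only [hE, mem_filter, mem_product, mem_biUnion, mem_singleton, Prod.exists]
      constructor
      · rintro ⟨⟨⟨h1, h2⟩, h3, h4⟩, h5, h6⟩
        exact ⟨x, y, ⟨h1, h2⟩, rfl, ⟨h3, h5⟩, h4, h6⟩
      · rintro ⟨x0, y0, ⟨h1, h2⟩, h, ⟨h3, h5⟩, h4, h6⟩
        obtain ⟨rfl, rfl⟩ := Prod.mk.injEq _ _ _ _ ▸ h
        exact ⟨⟨⟨h1, h2⟩, h3, h4⟩, h5, h6⟩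
    rw [this]
    refine card_biUnion_le.trans ?_
    rw [← card_product]
    apply sum_le_card_nsmul
    intro p _
    rw [card_product, card_product, card_singleton, one_mul]
    exact Nat.mul_le_mul (rk_fiber A a _ ha) (rk_fiber B b _ hb)
  rw [hI]
  calc ∑ l ∈ L, #{x ∈ A | l.1 * x + l.2 ∈ B}
      ≤ ∑ l ∈ L, ((#A / a + #B / b + 1) + #(D l)) := sum_le_sum key
    _ = #L * (#A / a + #B / b + 1) + ∑ l ∈ L, #(D l) := by
        rw [sum_add_distrib, sum_const, smul_eq_mul]
    _ ≤ _ := by omega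


theorem st_grid (A B : Finset ℝ) (L : Finset (ℝ × ℝ)) (hL : ∀ l ∈ L, l.1 ≠ 0) :
    (#{p ∈ L ×ˢ A | p.1.1 * p.2 + p.1.2 ∈ B} : ℝ) ≤ 8 * #L ∨
    (#{p ∈ L ×ˢ A | p.1.1 * p.2 + p.1.2 ∈ B} : ℝ) ^ 3 ≤ 512 * ((#A : ℝ) * #B * #L) ^ 2 := by
  set I := #{p ∈ L ×ˢ A | p.1.1 * p.2 + p.1.2 ∈ B} with hI
  have hIA : I ≤ #L * #A := by
    rw [← card_product]; exact card_filter_le _ _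
  have hIB : I ≤ #L * #B := by
    rw [← card_product]
    apply card_le_card_of_injOn (fun p => (p.1, p.1.1 * p.2 + p.1.2))
    · intro p hp
      simp only [coe_filter, mem_product, Set.mem_ofPred_eq] at hp
      simp [hp.1.1, hp.2]
    · rintro ⟨l, x⟩ hp ⟨l', x'⟩ hp' h
      simp only [coe_filter, mem_product, Set.mem_ofPred_eq] at hp hp'
      simp only [Prod.mk.injEq] at h
      obtain ⟨rfl, h⟩ := h
      have := hL l hp.1.1
      have : x = x' := by
        apply mul_left_cancel₀ this
        linarith
      rw [this]
  rcases Nat.eq_zero_or_pos (#L) with h0 | hk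
  · left; simp only [h0, zero_mul, nonpos_iff_eq_zero] at hIA; simp [hIA, h0]
  rcases Nat.eq_zero_or_pos (#A) with h0 | hn
  · left; simp only [h0, mul_zero, nonpos_iff_eq_zero] at hIA; simp [hIA]
  rcases Nat.eq_zero_or_pos (#B) with h0 | hm
  · left; simp only [h0, mul_zero, nonpos_iff_eq_zero] at hIB; simp [hIB]
  have hk' : (1:ℝ) ≤ #L := by exact_mod_cast hk
  have hn' : (1:ℝ) ≤ #A := by exact_mod_cast hn
  have hm' : (1:ℝ) ≤ #B := by exact_mod_cast hm
  have hIA' : (I:ℝ) ≤ #L * #A := by exact_mod_cast hIA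
  have hIB' : (I:ℝ) ≤ #L * #B := by exact_mod_cast hIB
  have hI0 : (0:ℝ) ≤ I := by positivity
  have core := fun a b ha hb => st_core A B L a b ha hb
  rw [← hI] at core
  set k : ℝ := ((#L : ℕ) : ℝ) with hkdef
  set n : ℝ := ((#A : ℕ) : ℝ) with hndef
  set m : ℝ := ((#B : ℕ) : ℝ) with hmdef
  obtain ⟨r, hr0, hr⟩ : ∃ r : ℝ, 0 < r ∧ r ^ 3 * k = n ^ 2 * m ^ 2 := by
    refine ⟨(n ^ 2 * m ^ 2 / k) ^ ((1:ℝ) / 3), by positivity, ?_⟩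
    rw [← Real.rpow_natCast, ← Real.rpow_mul (by positivity)]
    norm_num
    field_simp
  rcases lt_or_ge r 1 with h1 | h1
  · left
    have := core (#A) (#B) hn hm
    rw [Nat.div_self hn, Nat.div_self hm] at this
    have h2 : (I:ℝ) ≤ k * 3 + n * m * (n * m) := by
      have : (I:ℝ) ≤ ((#L * (1 + 1 + 1) + #A * #B * (#A * #B) : ℕ) : ℝ) := by exact_mod_cast this
      push_cast at this
      linarith
    have h3 : r ^ 3 ≤ 1 := pow_le_one₀ hr0.le h1.le
    nlinarith
  rcases lt_or_ge n r with h2 | h2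
  · right
    have h3 : n ^ 3 ≤ r ^ 3 := pow_le_pow_left₀ (by positivity) h2.le 3
    have h4 : n * k ≤ m ^ 2 := by
      have : n ^ 2 * (n * k) ≤ n ^ 2 * m ^ 2 := by nlinarith
      exact le_of_mul_le_mul_left this (by positivity)
    calc (I:ℝ) ^ 3 ≤ (k * n) ^ 3 := pow_le_pow_left₀ hI0 hIA' 3
      _ = (k * n) ^ 2 * (n * k) := by ring
      _ ≤ (k * n) ^ 2 * m ^ 2 := by gcongr
      _ ≤ 512 * (n * m * k) ^ 2 := by nlinarith [sq_nonneg (n * m * k)]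
  rcases lt_or_ge m r with h3 | h3
  · right
    have h3 : m ^ 3 ≤ r ^ 3 := pow_le_pow_left₀ (by positivity) h3.le 3
    have h4 : m * k ≤ n ^ 2 := by
      have : m ^ 2 * (m * k) ≤ m ^ 2 * n ^ 2 := by nlinarith
      exact le_of_mul_le_mul_left this (by positivity)
    calc (I:ℝ) ^ 3 ≤ (k * m) ^ 3 := pow_le_pow_left₀ hI0 hIB' 3
      _ = (k * m) ^ 2 * (m * k) := by ring
      _ ≤ (k * m) ^ 2 * n ^ 2 := by gcongr
      _ ≤ 512 * (n * m * k) ^ 2 := by nlinarith [sq_nonneg (n * m * k)]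
  right
  have ceil : ∀ x : ℕ, r ≤ (x:ℝ) → ∃ a : ℕ, 0 < a ∧ ((x / a : ℕ) : ℝ) ≤ r ∧ (a:ℝ) ≤ 2 * x / r := by
    intro x hx
    have hxr : 1 ≤ (x:ℝ) / r := by rwa [le_div_iff₀ hr0, one_mul]
    have hpos : 0 < ⌈(x:ℝ) / r⌉₊ := Nat.ceil_pos.2 (by linarith)
    refine ⟨⌈(x:ℝ) / r⌉₊, hpos, ?_, ?_⟩
    · refine Nat.cast_div_le.trans ?_
      rw [div_le_iff₀ (by exact_mod_cast hpos)]
      have := Nat.le_ceil ((x:ℝ) / r)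
      rw [div_le_iff₀ hr0] at this
      linarith
    · have := (Nat.ceil_lt_add_one (show 0 ≤ (x:ℝ) / r by positivity)).le
      rw [mul_div_assoc]
      linarith
  obtain ⟨a, ha, ha1, ha2⟩ := ceil (#A) h2
  obtain ⟨b, hb, hb1, hb2⟩ := ceil (#B) h3
  have h4 := core a b ha hb
  have h5 : (I:ℝ) ≤ k * (((#A / a : ℕ):ℝ) + ((#B / b : ℕ):ℝ) + 1) + n * m * (a * b) := by
    have : (I:ℝ) ≤ ((#L * (#A / a + #B / b + 1) + #A * #B * (a * b) : ℕ) : ℝ) := by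
      exact_mod_cast h4
    push_cast at this ⊢
    simpa using this
  have h6 : (a:ℝ) * b ≤ (2 * n / r) * (2 * m / r) := by gcongr
  have h7 : (I:ℝ) ≤ 7 * (r * k) := by
    calc (I:ℝ) ≤ k * (r + r + r) + n * m * ((2 * n / r) * (2 * m / r)) := by
          refine h5.trans ?_
          gcongr
      _ = 3 * (r * k) + 4 * (n ^ 2 * m ^ 2) / r ^ 2 := by field_simp; ring
      _ = 7 * (r * k) := by rw [← hr]; field_simp; ring
  calc (I:ℝ) ^ 3 ≤ (7 * (r * k)) ^ 3 := pow_le_pow_left₀ hI0 h7 3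
    _ = 343 * (r ^ 3 * k) * k ^ 2 := by ring
    _ = 343 * (n * m * k) ^ 2 := by rw [hr]; ring
    _ ≤ _ := by nlinarith [sq_nonneg (n * m * k)]


/-- number of points of the grid `A × B` on the line `y = l.1 x + l.2` -/
noncomputable def rich (A B : Finset ℝ) (l : ℝ × ℝ) : ℕ := #{x ∈ A | l.1 * x + l.2 ∈ B}

lemma inc_eq (A B : Finset ℝ) (L : Finset (ℝ × ℝ)) :
    #{p ∈ L ×ˢ A | p.1.1 * p.2 + p.1.2 ∈ B} = ∑ l ∈ L, rich A B l := by
  rw [card_filter, sum_product]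
  apply sum_congr rfl
  intro l _
  rw [rich, card_filter]

lemma st_rich (A B : Finset ℝ) (L : Finset (ℝ × ℝ)) (hL : ∀ l ∈ L, l.1 ≠ 0) (t : ℝ) (ht : 8 < t)
    (h : ∀ l ∈ L, t ≤ rich A B l) :
    (∑ l ∈ L, (rich A B l : ℝ)) * t ^ 2 ≤ 512 * ((#A : ℝ) * #B) ^ 2 := by
  have h1 := st_grid A B L hL
  rw [inc_eq] at h1
  push_cast at h1
  have h2 : t * #L ≤ ∑ l ∈ L, (rich A B l : ℝ) := by
    have := card_nsmul_le_sum L (fun l => (rich A B l : ℝ)) t h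
    rw [nsmul_eq_mul] at this
    linarith
  set I := ∑ l ∈ L, (rich A B l : ℝ) with hI
  have hk : (0:ℝ) ≤ #L := by positivity
  have hI0 : 0 ≤ I := by positivity
  rcases hI0.eq_or_lt with h0 | h0
  · rw [← h0, zero_mul]; positivity
  rcases h1 with h1 | h1
  · exfalso
    rcases hk.eq_or_lt with h3 | h3
    · rw [← h3] at h1; linarith
    · nlinarith
  · have h3 : (t * #L) ^ 2 ≤ I ^ 2 := pow_le_pow_left₀ (by positivity) h2 2
    have h4 : I ^ 2 * (I * t ^ 2) ≤ I ^ 2 * (512 * ((#A : ℝ) * #B) ^ 2) := by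
      calc I ^ 2 * (I * t ^ 2) = I ^ 3 * t ^ 2 := by ring
        _ ≤ 512 * ((#A : ℝ) * #B * #L) ^ 2 * t ^ 2 := by gcongr
        _ = 512 * ((#A : ℝ) * #B) ^ 2 * (t * #L) ^ 2 := by ring
        _ ≤ 512 * ((#A : ℝ) * #B) ^ 2 * I ^ 2 := by gcongr
        _ = _ := by ring
    exact le_of_mul_le_mul_left h4 (by positivity)

lemma card_diff_eq (X A : Finset ℝ) (hX : ∀ x ∈ X, 0 < x) (hA : ∀ x ∈ A, 0 < x)
    (hXn : X.Nonempty) (δ : ℝ) (hδ : δ ≠ 0) :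
    (#{p ∈ X ×ˢ (A ×ˢ A) | p.1 / p.2.1 - p.1 / p.2.2 = δ} : ℝ) ^ 3 ≤
      512 * #X * (#(image₂ (· / ·) X A) : ℝ) ^ 2 * (#A : ℝ) ^ 2 := by
  set T := ({p ∈ X ×ˢ (A ×ˢ A) | p.1 / p.2.1 - p.1 / p.2.2 = δ} : Finset (ℝ × ℝ × ℝ)) with hT
  set Q := image₂ (· / ·) X A with hQ
  set L : Finset (ℝ × ℝ) := (X ×ˢ A).image (fun p => (δ * p.1, p.1 / p.2)) with hL
  have hLc : #L = #X * #A := by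
    rw [hL, card_image_of_injOn, card_product]
    rintro ⟨x, a⟩ h ⟨x', a'⟩ h' heq
    simp only [coe_product, Set.mem_prod, mem_coe] at h h'
    simp only [Prod.mk.injEq] at heq
    have hx : x = x' := mul_left_cancel₀ hδ heq.1
    subst hx
    have h1 := hX x h.1
    have h2 := hA a h.2
    have h3 := hA a' h'.2
    have h4 := heq.2
    rw [div_eq_div_iff h2.ne' h3.ne'] at h4
    have : a' = a := mul_left_cancel₀ h1.ne' h4
    rw [this]
  have hst := st_grid (X.image (·⁻¹)) Q L (by
    intro l hl
    obtain ⟨p, hp, rfl⟩ := mem_image.1 hl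
    have := hX _ (mem_product.1 hp).1
    simp [hδ, this.ne'])
  have hcard : #(X.image (·⁻¹)) = #X := card_image_of_injective _ inv_injective
  have hinc : #X * #T ≤ #{p ∈ L ×ˢ (X.image (·⁻¹)) | p.1.1 * p.2 + p.1.2 ∈ Q} := by
    rw [← card_product]
    apply card_le_card_of_injOn (fun s => ((δ * s.1, s.1 / s.2.2.2), s.2.1⁻¹))
    · rintro ⟨x, y, a, a'⟩ h
      simp only [hT, coe_product, Set.mem_prod, mem_coe, mem_filter, mem_product] at h
      obtain ⟨hx, ⟨hy, ha, ha'⟩, he⟩ := h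
      simp only [coe_filter, mem_product, Set.mem_ofPred_eq]
      refine ⟨⟨mem_image.2 ⟨(x, a'), by simp [hx, ha'], rfl⟩, mem_image_of_mem _ hy⟩, ?_⟩
      have h1 := hX y hy
      have h2 := hA a ha
      have h3 := hA a' ha'
      have : δ * x * y⁻¹ + x / a' = x / a := by
        rw [← he]; field_simp; ring
      rw [this]
      exact mem_image₂_of_mem hx ha
    · rintro ⟨x, y, a, a'⟩ h ⟨x', y', b, b'⟩ h' heq
      simp only [hT, coe_product, Set.mem_prod, mem_coe, mem_filter, mem_product] at h h'
      obtain ⟨hx, ⟨hy, ha, ha'⟩, he⟩ := h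
      obtain ⟨hx', ⟨hy', hb, hb'⟩, he'⟩ := h'
      simp only [Prod.mk.injEq] at heq
      obtain ⟨⟨h1, h2⟩, h3⟩ := heq
      have hxx : x = x' := mul_left_cancel₀ hδ h1
      subst hxx
      have hyy : y = y' := inv_injective h3
      subst hyy
      have p1 := hX x hx
      have p2 := hX y hy
      have p3 := hA a ha
      have p4 := hA a' ha'
      have p5 := hA b hb
      have p6 := hA b' hb'
      rw [div_eq_div_iff p4.ne' p6.ne'] at h2
      have hab' : b' = a' := mul_left_cancel₀ p1.ne' h2
      subst hab'
      have h4 : y / a = y / b := by linarith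
      rw [div_eq_div_iff p3.ne' p5.ne'] at h4
      have hab : b = a := mul_left_cancel₀ p2.ne' h4
      rw [hab]
  have hinc' : (#X : ℝ) * #T ≤ #{p ∈ L ×ˢ (X.image (·⁻¹)) | p.1.1 * p.2 + p.1.2 ∈ Q} := by
    exact_mod_cast hinc
  rw [hcard, hLc] at hst
  set I : ℝ := ((#{p ∈ L ×ˢ (X.image (·⁻¹)) | p.1.1 * p.2 + p.1.2 ∈ Q} : ℕ) : ℝ) with hI
  have hx1 : (1:ℝ) ≤ #X := by exact_mod_cast hXn.card_pos
  have hQA : (#A:ℝ) ≤ #Q := by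
    obtain ⟨x, hx⟩ := hXn
    have : #(A.image (fun a => x / a)) = #A := by
      apply card_image_of_injOn
      intro a ha b hb hab
      have p1 := hX x hx
      have p3 := hA a ha
      have p5 := hA b hb
      simp only at hab
      rw [div_eq_div_iff p3.ne' p5.ne'] at hab
      exact (mul_left_cancel₀ p1.ne' hab).symm
    rw [← this]
    norm_cast
    apply card_le_card
    intro z hz
    obtain ⟨a, ha, rfl⟩ := mem_image.1 hz
    exact mem_image₂_of_mem hx ha
  push_cast at hst
  have hA0 : (0:ℝ) ≤ #A := by positivity
  rcases hst with hst | hst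
  · have h1 : (#T:ℝ) ≤ 8 * #A := by
      have : (#X:ℝ) * #T ≤ #X * (8 * #A) := by linarith
      exact le_of_mul_le_mul_left this (by linarith)
    have hAA : (#A:ℝ) ≤ (#A:ℝ) ^ 2 := by
      have : (#A : ℕ) ≤ #A ^ 2 := Nat.le_self_pow (by norm_num) _
      exact_mod_cast this
    calc (#T:ℝ) ^ 3 ≤ (8 * #A) ^ 3 := by gcongr
      _ = 512 * 1 * (#A:ℝ) * (#A:ℝ) ^ 2 := by ring
      _ ≤ 512 * #X * (#Q:ℝ) ^ 2 * (#A:ℝ) ^ 2 := by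
        gcongr
        nlinarith
  · have h2 : (#X:ℝ) ^ 3 * (#T:ℝ) ^ 3 ≤ #X ^ 3 * (512 * #X * (#Q:ℝ) ^ 2 * (#A:ℝ) ^ 2) := by
      calc (#X:ℝ) ^ 3 * (#T:ℝ) ^ 3 = (#X * #T) ^ 3 := by ring
        _ ≤ I ^ 3 := by gcongr
        _ ≤ _ := hst
        _ = _ := by ring
    exact le_of_mul_le_mul_left h2 (by positivity)


lemma energy_alt (X A F : Finset ℝ) (hX : ∀ x ∈ X, 0 < x) (hA : ∀ x ∈ A, 0 < x)
    (hXn : X.Nonempty) (hFn : F.Nonempty) (hAn : A.Nonempty) (ρ : ℝ) (hρ0 : 0 < ρ)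
    (hρ : ∀ y ∈ X, (#((F ×ˢ A).image (fun p => p.1 + y / p.2)) : ℝ) ≤ ρ)
    (hq : (#(image₂ (· / ·) X A) : ℝ) ≤ ρ) :
    (#F : ℝ) * #A ≤ 2 * ρ ∨ (#A : ℝ) ^ 4 * (#X : ℝ) ^ 2 ≤ 4096 * ρ ^ 5 := by
  set E : ℝ → Finset ((ℝ × ℝ) × (ℝ × ℝ)) := fun y =>
    {p ∈ (F ×ˢ A) ×ˢ (F ×ˢ A) | p.1.1 + y / p.1.2 = p.2.1 + y / p.2.2} with hE
  set q : ℝ := ((#(image₂ (· / ·) X A) : ℕ) : ℝ) with hqd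
  have hx1 : (1:ℝ) ≤ #X := by exact_mod_cast hXn.card_pos
  have hf1 : (1:ℝ) ≤ #F := by exact_mod_cast hFn.card_pos
  have ha1 : (1:ℝ) ≤ #A := by exact_mod_cast hAn.card_pos
  obtain ⟨H, hH0, hH⟩ : ∃ H : ℝ, 0 ≤ H ∧ (#X * H) ^ 3 = 512 * #X * q ^ 2 * (#A : ℝ) ^ 2 := by
    refine ⟨(512 * #X * q ^ 2 * (#A : ℝ) ^ 2) ^ ((1:ℝ) / 3) / #X, by positivity, ?_⟩
    rw [mul_div_cancel₀ _ (by positivity), ← Real.rpow_natCast, ← Real.rpow_mul (by positivity)]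
    norm_num
  have hsum : ∑ y ∈ X, #(E y) ≤
      ∑ g ∈ F ×ˢ F, #{p ∈ X ×ˢ (A ×ˢ A) | p.1 / p.2.1 - p.1 / p.2.2 = g.2 - g.1} := by
    rw [← card_sigma, ← card_sigma]
    apply card_le_card_of_injOn
      (fun s => (⟨(s.2.1.1, s.2.2.1), (s.1, (s.2.1.2, s.2.2.2))⟩ : (_ : ℝ × ℝ) × (ℝ × ℝ × ℝ)))
    · rintro ⟨y, ⟨f, a⟩, f', a'⟩ h
      simp only [hE, coe_sigma, Set.mem_sigma_iff, mem_coe, mem_filter, mem_product] at h ⊢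
      obtain ⟨hy, ⟨⟨h1, h2⟩, h3, h4⟩, h5⟩ := h
      refine ⟨⟨h1, h3⟩, ⟨hy, h2, h4⟩, by linarith⟩
    · rintro ⟨y, ⟨f, a⟩, f', a'⟩ h ⟨z, ⟨g, b⟩, g', b'⟩ h' heq
      simp only [Sigma.mk.injEq, Prod.mk.injEq, heq_eq_eq] at heq
      obtain ⟨⟨rfl, rfl⟩, rfl, rfl, rfl⟩ := heq
      rfl
  have hterm : ∀ g ∈ F ×ˢ F,
      (#{p ∈ X ×ˢ (A ×ˢ A) | p.1 / p.2.1 - p.1 / p.2.2 = g.2 - g.1} : ℝ) ≤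
        (if g.1 = g.2 then (#X * #A : ℝ) else 0) + #X * H := by
    intro g _
    split_ifs with h
    · have : #{p ∈ X ×ˢ (A ×ˢ A) | p.1 / p.2.1 - p.1 / p.2.2 = g.2 - g.1} ≤ #(X ×ˢ A) := by
        apply card_le_card_of_injOn (fun s => (s.1, s.2.1))
        · rintro ⟨y, a, a'⟩ hs
          simp only [coe_filter, mem_product, Set.mem_ofPred_eq] at hs
          simp [hs.1.1, hs.1.2.1]
        · rintro ⟨y, a, a'⟩ hs ⟨z, b, b'⟩ hs' heq
          simp only [coe_filter, mem_product, Set.mem_ofPred_eq] at hs hs'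
          simp only [Prod.mk.injEq] at heq
          obtain ⟨rfl, rfl⟩ := heq
          have p1 := hX y hs.1.1
          have p2 := hA a' hs.1.2.2
          have p3 := hA b' hs'.1.2.2
          have h4 : y / a' = y / b' := by linarith [hs.2, hs'.2]
          rw [div_eq_div_iff p2.ne' p3.ne'] at h4
          have hab : b' = a' := mul_left_cancel₀ p1.ne' h4
          rw [hab]
      rw [card_product] at this
      have h2 : (#{p ∈ X ×ˢ (A ×ˢ A) | p.1 / p.2.1 - p.1 / p.2.2 = g.2 - g.1} : ℝ) ≤ #X * #A := by
        exact_mod_cast this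
      have : 0 ≤ #X * H := by positivity
      linarith
    · rw [zero_add]
      have := card_diff_eq X A hX hA hXn (g.2 - g.1) (fun h' => h (by linarith))
      rw [← hqd, ← hH] at this
      exact le_of_pow_le_pow_left₀ (by norm_num) (by positivity) this
  have hsum2 : (∑ y ∈ X, (#(E y) : ℝ)) ≤ #F * (#X * #A) + (#F : ℝ) ^ 2 * (#X * H) := by
    calc (∑ y ∈ X, (#(E y) : ℝ)) ≤
        ∑ g ∈ F ×ˢ F, (#{p ∈ X ×ˢ (A ×ˢ A) | p.1 / p.2.1 - p.1 / p.2.2 = g.2 - g.1} : ℝ) := by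
          exact_mod_cast hsum
      _ ≤ ∑ g ∈ F ×ˢ F, ((if g.1 = g.2 then (#X * #A : ℝ) else 0) + #X * H) := sum_le_sum hterm
      _ = _ := by
        have hin : ∀ f ∈ F, ∑ f' ∈ F, (if f = f' then (#X * #A : ℝ) else 0) = #X * #A := by
          intro f hf
          rw [sum_ite_eq, if_pos hf]
        rw [sum_add_distrib, sum_const, card_product, sum_product, sum_congr rfl hin, sum_const,
          nsmul_eq_mul, nsmul_eq_mul]
        push_cast
        ring
  have hcs : ∀ y ∈ X, ((#F : ℝ) * #A) ^ 2 ≤ ρ * #(E y) := by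
    intro y hy
    have h1 := cs_card (F ×ˢ A) (fun p => p.1 + y / p.2)
    rw [card_product] at h1
    have h2 : ((#F : ℝ) * #A) ^ 2 ≤ (#((F ×ˢ A).image (fun p => p.1 + y / p.2)) : ℝ) * #(E y) := by
      exact_mod_cast h1
    refine h2.trans ?_
    gcongr
    exact hρ y hy
  have hall : #X * ((#F : ℝ) * #A) ^ 2 ≤ ρ * (#F * (#X * #A) + (#F : ℝ) ^ 2 * (#X * H)) := by
    calc #X * ((#F : ℝ) * #A) ^ 2 = ∑ y ∈ X, ((#F : ℝ) * #A) ^ 2 := by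
          rw [sum_const, nsmul_eq_mul]
      _ ≤ ∑ y ∈ X, ρ * #(E y) := sum_le_sum hcs
      _ = ρ * ∑ y ∈ X, (#(E y) : ℝ) := by rw [mul_sum]
      _ ≤ _ := by gcongr
  set k : ℝ := ((#F : ℕ) : ℝ)
  set N : ℝ := ((#A : ℕ) : ℝ)
  set x : ℝ := ((#X : ℕ) : ℝ)
  have h1 : k * N ^ 2 ≤ ρ * (N + k * H) := by
    have : (x * k) * (k * N ^ 2) ≤ (x * k) * (ρ * (N + k * H)) := by nlinarith
    exact le_of_mul_le_mul_left this (by positivity)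
  rcases le_total (k * H) N with h2 | h2
  · left
    have : N * (k * N) ≤ N * (2 * ρ) := by nlinarith
    exact le_of_mul_le_mul_left this (by positivity)
  · right
    have h3 : N ^ 2 ≤ 2 * ρ * H := by
      have : k * (N ^ 2) ≤ k * (2 * ρ * H) := by nlinarith
      exact le_of_mul_le_mul_left this (by positivity)
    have h4 : (N ^ 2) ^ 3 ≤ (2 * ρ * H) ^ 3 := pow_le_pow_left₀ (by positivity) h3 3
    have h5 : (x * N ^ 2) * (N ^ 4 * x ^ 2) ≤ (x * N ^ 2) * (4096 * ρ ^ 5) := by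
      calc (x * N ^ 2) * (N ^ 4 * x ^ 2) = x ^ 3 * (N ^ 2) ^ 3 := by ring
        _ ≤ x ^ 3 * (2 * ρ * H) ^ 3 := by gcongr
        _ = 8 * ρ ^ 3 * (x * H) ^ 3 := by ring
        _ = 8 * ρ ^ 3 * (512 * x * q ^ 2 * N ^ 2) := by rw [hH]
        _ ≤ 8 * ρ ^ 3 * (512 * x * ρ ^ 2 * N ^ 2) := by gcongr
        _ = _ := by ring
    exact le_of_mul_le_mul_left h5 (by positivity)

noncomputable def SS (A : Finset ℝ) : Finset ℝ := image₂ (· + ·) (image₂ (· / ·) A A) A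

noncomputable def XX (A : Finset ℝ) (l : ℝ) : Finset ℝ := {x ∈ A | l * x ∈ A}

lemma mem_SS {A : Finset ℝ} {a b c : ℝ} (ha : a ∈ A) (hb : b ∈ A) (hc : c ∈ A) :
    c + a / b ∈ SS A := by
  rw [add_comm]
  exact mem_image₂_of_mem (mem_image₂_of_mem ha hb) hc

lemma line_alt (A : Finset ℝ) (hA : ∀ x ∈ A, 0 < x) (l c : ℝ)
    (hX : (XX A l).Nonempty) (hk : 0 < rich A A (l, c)) :
    (#A : ℝ) ≤ rich (SS A) (SS A) (l, c) ∧
    ((rich A A (l, c) : ℝ) * #A ≤ 2 * rich (SS A) (SS A) (l, c) ∨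
      (#A : ℝ) ^ 4 * (#(XX A l) : ℝ) ^ 2 ≤ 4096 * (rich (SS A) (SS A) (l, c) : ℝ) ^ 5) := by
  have hXpos : ∀ x ∈ XX A l, 0 < x := fun x hx => hA x (mem_filter.1 hx).1
  have hFn : ({x ∈ A | l * x + c ∈ A} : Finset ℝ).Nonempty := card_pos.1 hk
  have hmem : ∀ p ∈ ({x ∈ A | l * x + c ∈ A} : Finset ℝ), ∀ y ∈ XX A l, ∀ a ∈ A,
      p + y / a ∈ ({x ∈ SS A | l * x + c ∈ SS A} : Finset ℝ) := by
    intro p hp y hy a ha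
    simp only [XX, mem_filter] at hp hy ⊢
    refine ⟨mem_SS hy.1 ha hp.1, ?_⟩
    have : l * (p + y / a) + c = (l * p + c) + (l * y) / a := by ring
    rw [this]
    exact mem_SS hy.2 ha hp.2
  obtain ⟨p, hp⟩ := hFn
  obtain ⟨y, hy⟩ := hX
  have hAn : A.Nonempty := ⟨p, (mem_filter.1 hp).1⟩
  have hN : #A ≤ rich (SS A) (SS A) (l, c) := by
    apply card_le_card_of_injOn (fun a => p + y / a)
    · intro a ha
      exact hmem p hp y hy a ha
    · intro a ha b hb hab
      have p1 := hXpos y hy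
      have p2 := hA a ha
      have p3 := hA b hb
      have h4 : y / a = y / b := by simpa using hab
      rw [div_eq_div_iff p2.ne' p3.ne'] at h4
      exact (mul_left_cancel₀ p1.ne' h4).symm
  have hN' : (#A : ℝ) ≤ rich (SS A) (SS A) (l, c) := by exact_mod_cast hN
  refine ⟨hN', ?_⟩
  apply energy_alt (XX A l) A {x ∈ A | l * x + c ∈ A} hXpos hA ⟨y, hy⟩ ⟨p, hp⟩ hAn
  · have : 0 < #A := hAn.card_pos
    exact_mod_cast this.trans_le hN
  · intro y hy
    have : #((({x ∈ A | l * x + c ∈ A} : Finset ℝ) ×ˢ A).image (fun p => p.1 + y / p.2)) ≤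
        rich (SS A) (SS A) (l, c) := by
      apply card_le_card
      intro z hz
      obtain ⟨⟨p, a⟩, hpa, rfl⟩ := mem_image.1 hz
      rw [mem_product] at hpa
      exact hmem p hpa.1 y hy a hpa.2
    exact_mod_cast this
  · have : #(image₂ (· / ·) (XX A l) A) ≤ rich (SS A) (SS A) (l, c) := by
      apply card_le_card_of_injOn (fun z => p + z)
      · intro z hz
        obtain ⟨y, hy, a, ha, rfl⟩ := mem_image₂.1 hz
        exact hmem p hp y hy a ha
      · intro a _ b _ hab
        simpa using hab
    exact_mod_cast this


theorem part_one (A Λ : Finset ℝ) (hA : ∀ x ∈ A, 0 < x) (hΛ : ∀ l ∈ Λ, 0 < l)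
    (hΛn : Λ.Nonempty) (hΛc : #Λ ≤ #A ^ 2)
    (τ t : ℝ) (hτ : 1 ≤ τ) (hX : ∀ l ∈ Λ, τ ≤ #(XX A l)) (hN : 128 ≤ #A)
    (ht : 0 < t) (ht5 : 4096 * t ^ 5 = (#A : ℝ) ^ 4 * τ ^ 2) :
    (#A : ℝ) ^ 5 * #Λ ≤ 3072 * (#(SS A) : ℝ) ^ 4 ∨
    (#Λ : ℝ) * √(#Λ : ℝ) * #A * t ^ 3 ≤ 61440 * (#(SS A) : ℝ) ^ 4 := by
  set L : Finset (ℝ × ℝ) := (Λ ×ˢ (A ×ˢ A)).image (fun p => (p.1, p.2.2 - p.1 * p.2.1)) with hL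
  have hmemL : ∀ l ∈ L, l.1 ∈ Λ ∧ 0 < rich A A l := by
    intro l hl
    obtain ⟨⟨m, p, q⟩, h, rfl⟩ := mem_image.1 hl
    simp only [mem_product] at h
    refine ⟨h.1, card_pos.2 ⟨p, ?_⟩⟩
    simp only [mem_filter]
    refine ⟨h.2.1, ?_⟩
    have : m * p + (q - m * p) = q := by ring
    rw [this]
    exact h.2.2
  have hmass : #Λ * #A ^ 2 ≤ ∑ l ∈ L, rich A A l := by
    rw [← inc_eq, sq, ← card_product, ← card_product]
    apply card_le_card_of_injOn (fun p => ((p.1, p.2.2 - p.1 * p.2.1), p.2.1))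
    · rintro ⟨m, p, q⟩ h
      simp only [coe_product, Set.mem_prod, mem_coe] at h
      simp only [coe_filter, mem_product, Set.mem_ofPred_eq]
      refine ⟨⟨mem_image.2 ⟨(m, p, q), by simp [h], rfl⟩, h.2.1⟩, ?_⟩
      have : m * p + (q - m * p) = q := by ring
      rw [this]
      exact h.2.2
    · rintro ⟨m, p, q⟩ h ⟨m', p', q'⟩ h' heq
      simp only [Prod.mk.injEq] at heq
      obtain ⟨⟨rfl, h1⟩, rfl⟩ := heq
      have : q = q' := by linarith
      rw [this]
  have hslope : ∀ l ∈ L, l.1 ≠ 0 := fun l hl => (hΛ _ (hmemL l hl).1).ne'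
  have hN'' : (128:ℝ) ≤ ((#A : ℕ) : ℝ) := by exact_mod_cast hN
  have hK1'' : (1:ℝ) ≤ ((#Λ : ℕ) : ℝ) := by exact_mod_cast hΛn.card_pos
  have hKN'' : ((#Λ : ℕ) : ℝ) ≤ ((#A : ℕ) : ℝ) ^ 2 := by exact_mod_cast hΛc
  have hmass'' : ((#Λ : ℕ) : ℝ) * ((#A : ℕ) : ℝ) ^ 2 ≤ ∑ l ∈ L, (rich A A l : ℝ) := by
    exact_mod_cast hmass
  set N : ℝ := ((#A : ℕ) : ℝ) with hNd
  set K : ℝ := ((#Λ : ℕ) : ℝ) with hKd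
  set S4 : ℝ := (#(SS A) : ℝ) ^ 4 with hS4
  have hN' : (128:ℝ) ≤ N := hN''
  have hK1 : (1:ℝ) ≤ K := hK1''
  have hKN : K ≤ N ^ 2 := hKN''
  have hs0 : 0 < √K := Real.sqrt_pos.2 (by linarith)
  have hss : √K ^ 2 = K := Real.sq_sqrt (by linarith)
  have hsN : √K ≤ N := Real.sqrt_le_iff.2 ⟨by linarith, hKN⟩
  set m0 : ℝ := 40 * N / √K with hm0
  have hm08 : 8 < m0 := by
    rw [hm0, lt_div_iff₀ hs0]; nlinarith
  have ht8 : 8 < t := by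
    by_contra h
    push Not at h
    have h1 : t ^ 5 ≤ 8 ^ 5 := pow_le_pow_left₀ ht.le h 5
    have h2 : (128:ℝ) ^ 4 ≤ N ^ 4 := pow_le_pow_left₀ (by norm_num) hN' 4
    have h3 : (1:ℝ) ≤ τ ^ 2 := one_le_pow₀ hτ
    nlinarith
  set k : ℝ × ℝ → ℝ := fun l => (rich A A l : ℝ) with hk
  set r : ℝ × ℝ → ℝ := fun l => (rich (SS A) (SS A) l : ℝ) with hr
  have hk0 : ∀ l, 0 ≤ k l := fun l => by positivity
  have halt : ∀ l ∈ L, N ≤ r l ∧ (k l * N ≤ 2 * r l ∨ t ≤ r l) := by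
    intro l hl
    have h1 := hmemL l hl
    have h2 := hX l.1 h1.1
    have h3 := line_alt A hA l.1 l.2 (card_pos.1 (by
      have : (0:ℝ) < #(XX A l.1) := by linarith
      exact_mod_cast this)) h1.2
    refine ⟨h3.1, h3.2.imp id (fun h => ?_)⟩
    have h4 : t ^ 5 ≤ r l ^ 5 := by
      have : N ^ 4 * τ ^ 2 ≤ N ^ 4 * (#(XX A l.1) : ℝ) ^ 2 := by gcongr
      have h' : N ^ 4 * (#(XX A l.1) : ℝ) ^ 2 ≤ 4096 * r l ^ 5 := h
      linarith
    exact le_of_pow_le_pow_left₀ (by norm_num) (by positivity) h4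
  have hmass' : K * N ^ 2 ≤ ∑ l ∈ L, k l := hmass''
  have hB : (∑ l ∈ L with m0 < k l, k l) * m0 ^ 2 ≤ 512 * (N * N) ^ 2 :=
    st_rich A A _ (fun l hl => hslope l (mem_filter.1 hl).1) m0 hm08
      (fun l hl => (mem_filter.1 hl).2.le)
  have hC : (∑ l ∈ {l ∈ L | ¬ m0 < k l} with k l * N ≤ 2 * r l, k l) * N ^ 3 ≤ 1024 * S4 := by
    have h1 := st_rich (SS A) (SS A) {l ∈ {l ∈ L | ¬ m0 < k l} | k l * N ≤ 2 * r l}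
      (fun l hl => hslope l (mem_filter.1 (mem_filter.1 hl).1).1) N (by linarith)
      (fun l hl => (halt l (mem_filter.1 (mem_filter.1 hl).1).1).1)
    have h2 : (∑ l ∈ {l ∈ L | ¬ m0 < k l} with k l * N ≤ 2 * r l, k l) * N ≤
        2 * ∑ l ∈ {l ∈ L | ¬ m0 < k l} with k l * N ≤ 2 * r l, r l := by
      rw [sum_mul, mul_sum]
      exact sum_le_sum (fun l hl => (mem_filter.1 hl).2)
    have h3 : 512 * ((#(SS A) : ℝ) * #(SS A)) ^ 2 = 512 * S4 := by rw [hS4]; ring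
    rw [h3] at h1
    calc (∑ l ∈ {l ∈ L | ¬ m0 < k l} with k l * N ≤ 2 * r l, k l) * N ^ 3
        = ((∑ l ∈ {l ∈ L | ¬ m0 < k l} with k l * N ≤ 2 * r l, k l) * N) * N ^ 2 := by ring
      _ ≤ (2 * ∑ l ∈ {l ∈ L | ¬ m0 < k l} with k l * N ≤ 2 * r l, r l) * N ^ 2 := by gcongr
      _ = 2 * ((∑ l ∈ {l ∈ L | ¬ m0 < k l} with k l * N ≤ 2 * r l, r l) * N ^ 2) := by ring
      _ ≤ 2 * (512 * S4) := by gcongr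
      _ = _ := by ring
  have hD : (∑ l ∈ {l ∈ L | ¬ m0 < k l} with ¬ k l * N ≤ 2 * r l, k l) * t ^ 3 ≤
      512 * S4 * m0 := by
    set D := ({l ∈ {l ∈ L | ¬ m0 < k l} | ¬ k l * N ≤ 2 * r l} : Finset (ℝ × ℝ)) with hDd
    have htr : ∀ l ∈ D, t ≤ r l := fun l hl =>
      (halt l (mem_filter.1 (mem_filter.1 hl).1).1).2.resolve_left (mem_filter.1 hl).2
    have h1 := st_rich (SS A) (SS A) D
      (fun l hl => hslope l (mem_filter.1 (mem_filter.1 hl).1).1) t ht8 htr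
    have h3 : 512 * ((#(SS A) : ℝ) * #(SS A)) ^ 2 = 512 * S4 := by rw [hS4]; ring
    rw [h3] at h1
    have h2 : ∑ l ∈ D, k l ≤ #D * m0 := by
      rw [← nsmul_eq_mul]
      exact sum_le_card_nsmul _ _ _ (fun l hl => not_lt.1 (mem_filter.1 (mem_filter.1 hl).1).2)
    have h4 : #D * t ≤ ∑ l ∈ D, r l := by
      rw [← nsmul_eq_mul]
      exact card_nsmul_le_sum _ _ _ htr
    calc (∑ l ∈ D, k l) * t ^ 3 ≤ (#D * m0) * t ^ 3 := by gcongr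
      _ = (#D * t) * t ^ 2 * m0 := by ring
      _ ≤ (∑ l ∈ D, r l) * t ^ 2 * m0 := by gcongr
      _ ≤ 512 * S4 * m0 := by gcongr
  have hsplit : ∑ l ∈ L, k l = (∑ l ∈ L with m0 < k l, k l) +
      ((∑ l ∈ {l ∈ L | ¬ m0 < k l} with k l * N ≤ 2 * r l, k l) +
      (∑ l ∈ {l ∈ L | ¬ m0 < k l} with ¬ k l * N ≤ 2 * r l, k l)) := by
    rw [sum_filter_add_sum_filter_not, sum_filter_add_sum_filter_not]
  set a := ∑ l ∈ L with m0 < k l, k l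
  set b := ∑ l ∈ {l ∈ L | ¬ m0 < k l} with k l * N ≤ 2 * r l, k l
  set d := ∑ l ∈ {l ∈ L | ¬ m0 < k l} with ¬ k l * N ≤ 2 * r l, k l
  have ha : a ≤ K * N ^ 2 / 3 := by
    have h1 : m0 ^ 2 = 1600 * N ^ 2 / K := by rw [hm0, div_pow, hss]; ring
    rw [h1] at hB
    have h2 : a * 1600 * N ^ 2 ≤ (512 * K * N ^ 2) * N ^ 2 := by
      have : a * (1600 * N ^ 2 / K) = a * 1600 * N ^ 2 / K := by ring
      rw [this, div_le_iff₀ (by linarith)] at hB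
      linarith
    have h3 : a * 1600 ≤ 512 * K * N ^ 2 := le_of_mul_le_mul_right h2 (by positivity)
    have : 0 ≤ K * N ^ 2 := by positivity
    linarith
  have hbd : K * N ^ 2 / 3 ≤ b ∨ K * N ^ 2 / 3 ≤ d := by
    by_contra h
    push Not at h
    linarith
  rcases hbd with h | h
  · left
    have : K * N ^ 2 / 3 * N ^ 3 ≤ 1024 * S4 := le_trans (by gcongr) hC
    linarith
  · right
    have h1 : K * N ^ 2 / 3 * t ^ 3 ≤ 512 * S4 * m0 := le_trans (by gcongr) hD
    have h2 : m0 * √K = 40 * N := by rw [hm0]; field_simp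
    have h3 : N * (K * √K * N * t ^ 3) ≤ N * (61440 * S4) := by
      have : K * N ^ 2 / 3 * t ^ 3 * √K ≤ 512 * S4 * m0 * √K := by gcongr
      have h4 : 512 * S4 * m0 * √K = 512 * S4 * (m0 * √K) := by ring
      rw [h4, h2] at this
      linarith
    exact le_of_mul_le_mul_left h3 (by positivity)


lemma gen_count (U X Y W : Finset ℝ) (α β γ : ℝ) (hα : α ≠ 0) (hβ : β ≠ 0) (hγ : γ ≠ 0)
    (hY : ∀ y ∈ Y, y ≠ 0) :
    (#{p ∈ (U ×ˢ X) ×ˢ (Y ×ˢ W) | α * p.2.1 * p.1.1 + β * p.1.2 = γ * p.2.2} : ℝ) ≤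
        8 * (#Y * #W) ∨
    (#{p ∈ (U ×ˢ X) ×ˢ (Y ×ˢ W) | α * p.2.1 * p.1.1 + β * p.1.2 = γ * p.2.2} : ℝ) ^ 3 ≤
        512 * ((#U : ℝ) * #X * (#Y * #W)) ^ 2 := by
  set L : Finset (ℝ × ℝ) := (Y ×ˢ W).image (fun p => (-(α / β) * p.1, γ / β * p.2)) with hL
  have hinj : Function.Injective (fun p : ℝ × ℝ => (-(α / β) * p.1, γ / β * p.2)) := by
    rintro ⟨a, b⟩ ⟨c, d⟩ h
    simp only [Prod.mk.injEq] at h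
    have h1 := mul_left_cancel₀ (neg_ne_zero.2 (div_ne_zero hα hβ)) h.1
    have h2 := mul_left_cancel₀ (div_ne_zero hγ hβ) h.2
    rw [h1, h2]
  have hLc : (#L : ℝ) = #Y * #W := by
    rw [hL, card_image_of_injective _ hinj, card_product]; push_cast; rfl
  have hs : ∀ l ∈ L, l.1 ≠ 0 := by
    intro l hl
    obtain ⟨p, hp, rfl⟩ := mem_image.1 hl
    exact mul_ne_zero (neg_ne_zero.2 (div_ne_zero hα hβ)) (hY _ (mem_product.1 hp).1)
  have hle : #{p ∈ (U ×ˢ X) ×ˢ (Y ×ˢ W) | α * p.2.1 * p.1.1 + β * p.1.2 = γ * p.2.2} ≤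
      #{p ∈ L ×ˢ U | p.1.1 * p.2 + p.1.2 ∈ X} := by
    apply card_le_card_of_injOn (fun p => ((-(α / β) * p.2.1, γ / β * p.2.2), p.1.1))
    · rintro ⟨⟨u, x⟩, ⟨y, w⟩⟩ h
      simp only [coe_filter, mem_product, Set.mem_ofPred_eq] at h ⊢
      obtain ⟨⟨⟨hu, hx⟩, hy, hw⟩, he⟩ := h
      refine ⟨⟨mem_image.2 ⟨(y, w), mem_product.2 ⟨hy, hw⟩, rfl⟩, hu⟩, ?_⟩
      have : -(α / β) * y * u + γ / β * w = x := by
        field_simp; linarith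
      rwa [this]
    · rintro ⟨⟨u, x⟩, ⟨y, w⟩⟩ h ⟨⟨u', x'⟩, ⟨y', w'⟩⟩ h' heq
      simp only [coe_filter, mem_product, Set.mem_ofPred_eq] at h h'
      simp only [Prod.mk.injEq] at heq
      obtain ⟨⟨h1, h2⟩, rfl⟩ := heq
      have h1 := mul_left_cancel₀ (neg_ne_zero.2 (div_ne_zero hα hβ)) h1
      have h2 := mul_left_cancel₀ (div_ne_zero hγ hβ) h2
      subst h1 h2
      have : x = x' := mul_left_cancel₀ hβ (by linarith [h.2, h'.2])
      rw [this]
  have hle' : (#{p ∈ (U ×ˢ X) ×ˢ (Y ×ˢ W) | α * p.2.1 * p.1.1 + β * p.1.2 = γ * p.2.2} : ℝ) ≤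
      #{p ∈ L ×ˢ U | p.1.1 * p.2 + p.1.2 ∈ X} := by exact_mod_cast hle
  have hst := st_grid U X L hs
  rw [hLc] at hst
  rcases hst with h | h
  · left; exact hle'.trans h
  · right
    refine le_trans (pow_le_pow_left₀ (by positivity) hle' 3) h

noncomputable def CC (A : Finset ℝ) (i j k l : ℝ) : Finset ((ℝ × ℝ × ℝ) × (ℝ × ℝ × ℝ)) :=
  {w ∈ (XX A i ×ˢ (A ×ˢ XX A j)) ×ˢ (XX A k ×ˢ (A ×ˢ XX A l)) |
    w.1.1 / w.1.2.1 + w.1.2.2 = w.2.1 / w.2.2.1 + w.2.2.2 ∧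
    i * (w.1.1 / w.1.2.1) + j * w.1.2.2 = k * (w.2.1 / w.2.2.1) + l * w.2.2.2}

lemma XX_sub (A : Finset ℝ) (l : ℝ) : XX A l ⊆ A := filter_subset _ _

lemma coll_diag (A : Finset ℝ) (hA : ∀ a ∈ A, 0 < a) (i j τ : ℝ) (hij : i < j) (hτ : 0 ≤ τ)
    (hi : (#(XX A i) : ℝ) ≤ 2 * τ) (hj : (#(XX A j) : ℝ) ≤ 2 * τ) :
    (#(CC A i j i j) : ℝ) ≤ 8 * τ ^ 3 * #A := by
  have h : #(CC A i j i j) ≤ #((XX A i ×ˢ (A ×ˢ XX A j)) ×ˢ XX A i) := by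
    apply card_le_card_of_injOn (fun w => (w.1, w.2.1))
    · rintro ⟨w1, ⟨y, a, x⟩⟩ h
      simp only [CC, coe_filter, mem_product, Set.mem_ofPred_eq] at h
      simp only [coe_product, Set.mem_prod, mem_coe, mem_product]
      exact ⟨h.1.1, h.1.2.1⟩
    · rintro ⟨⟨y0, a0, x0⟩, ⟨y, a, x⟩⟩ h ⟨⟨y0', a0', x0'⟩, ⟨y', a', x'⟩⟩ h' heq
      simp only [CC, coe_filter, mem_product, Set.mem_ofPred_eq] at h h'
      simp only [Prod.mk.injEq] at heq
      obtain ⟨⟨rfl, rfl, rfl⟩, rfl⟩ := heq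
      have hx : x0 = x := mul_left_cancel₀ (sub_ne_zero.2 hij.ne') (by
        linear_combination h.2.2 - i * h.2.1)
      have hx' : x0 = x' := mul_left_cancel₀ (sub_ne_zero.2 hij.ne') (by
        linear_combination h'.2.2 - i * h'.2.1)
      subst hx
      subst hx'
      have hy := hA _ (XX_sub A i h.1.2.1)
      have ha := hA _ h.1.2.2.1
      have ha' := hA _ h'.1.2.2.1
      have he : y / a = y / a' := by linarith [h.2.1, h'.2.1]
      have : a = a' := by
        field_simp at he; linarith
      rw [this]
  have h2 : (#(CC A i j i j) : ℝ) ≤ #(XX A i) * (#A * #(XX A j)) * #(XX A i) := by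
    refine le_trans (Nat.cast_le.2 h) (le_of_eq ?_)
    simp only [card_product]; push_cast; ring
  calc (#(CC A i j i j) : ℝ) ≤ #(XX A i) * (#A * #(XX A j)) * #(XX A i) := h2
    _ ≤ (2 * τ) * (#A * (2 * τ)) * (2 * τ) := by gcongr
    _ = _ := by ring

lemma coll_off (A : Finset ℝ) (hA : ∀ a ∈ A, 0 < a) (i j k l τ : ℝ) (hij : i < j) (hil : i < l)
    (hkj : k < j) (hkl : k < l) (hne : ¬ (i = k ∧ j = l)) (hτ : 1 ≤ τ) (hτA : τ ≤ #A)
    (hi : (#(XX A i) : ℝ) ≤ 2 * τ) (hj : (#(XX A j) : ℝ) ≤ 2 * τ)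
    (hk : (#(XX A k) : ℝ) ≤ 2 * τ) :
    (#(CC A i j k l) : ℝ) ^ 3 ≤ 2 ^ 18 * (#A : ℝ) ^ 4 * τ ^ 7 := by
  have hN0 : (1:ℝ) ≤ #A := hτ.trans hτA
  obtain ⟨B, hB0, hB⟩ : ∃ B : ℝ, 0 ≤ B ∧ B ^ 3 = 2 ^ 15 * (#A : ℝ) ^ 4 * τ ^ 4 := by
    refine ⟨(2 ^ 15 * (#A : ℝ) ^ 4 * τ ^ 4) ^ ((1:ℝ) / 3), by positivity, ?_⟩
    rw [← Real.rpow_natCast, ← Real.rpow_mul (by positivity)]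
    norm_num
  have hU : #(A.image (fun a => a⁻¹)) = #A := card_image_of_injective _ inv_injective
  have hXi : ∀ y ∈ XX A i, y ≠ 0 := fun y hy => (hA y (XX_sub A i hy)).ne'
  have hfib : ∀ y' ∈ XX A k, (#{w ∈ CC A i j k l | w.2.1 = y'} : ℝ) ≤ B := by
    intro y' hy'
    have hy0 : y' ≠ 0 := (hA y' (XX_sub A k hy')).ne'
    apply le_of_pow_le_pow_left₀ (n := 3) (by norm_num) hB0
    rw [hB]
    by_cases hjl : j = l
    · have hik : i ≠ k := fun h => hne ⟨h, hjl⟩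
      subst hjl
      have hg := gen_count (A.image (fun a => a⁻¹)) (XX A j) (XX A i) (XX A j) (k - i) (k - j)
        (k - j) (sub_ne_zero.2 hik.symm) (sub_ne_zero.2 hkj.ne) (sub_ne_zero.2 hkj.ne) hXi
      set G := {p ∈ (A.image (fun a => a⁻¹) ×ˢ XX A j) ×ˢ (XX A i ×ˢ XX A j) |
        (k - i) * p.2.1 * p.1.1 + (k - j) * p.1.2 = (k - j) * p.2.2} with hG
      have hle : #{w ∈ CC A i j k j | w.2.1 = y'} ≤ #G := by
        apply card_le_card_of_injOn (fun w => ((w.1.2.1⁻¹, w.1.2.2), (w.1.1, w.2.2.2)))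
        · rintro ⟨⟨y0, a0, x0⟩, ⟨y, a, x⟩⟩ h
          simp only [CC, coe_filter, mem_filter, mem_product, Set.mem_ofPred_eq] at h
          simp only [hG, coe_filter, mem_product, Set.mem_ofPred_eq]
          refine ⟨⟨⟨mem_image_of_mem _ h.1.1.1.2.1, h.1.1.1.2.2⟩, h.1.1.1.1, h.1.1.2.2.2⟩, ?_⟩
          have h1 := h.1.2.1
          have h2 := h.1.2.2
          rw [div_eq_mul_inv y0 a0] at h1 h2
          linear_combination k * h1 - h2
        · rintro ⟨⟨y0, a0, x0⟩, ⟨y, a, x⟩⟩ h ⟨⟨y0', a0', x0'⟩, ⟨z, a', x'⟩⟩ h' heq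
          simp only [CC, coe_filter, mem_filter, mem_product, Set.mem_ofPred_eq] at h h'
          simp only [Prod.mk.injEq, inv_inj] at heq
          obtain ⟨⟨rfl, rfl⟩, rfl, rfl⟩ := heq
          obtain ⟨⟨hm, h1, -⟩, rfl⟩ := h
          obtain ⟨⟨hm', h1', -⟩, rfl⟩ := h'
          have ha := hA _ hm.2.2.1
          have ha' := hA _ hm'.2.2.1
          have he : z / a = z / a' := by linarith
          have : a = a' := by
            field_simp at he; linarith
          rw [this]
      have hle' : (#{w ∈ CC A i j k j | w.2.1 = y'} : ℝ) ≤ #G := by exact_mod_cast hle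
      refine le_trans (pow_le_pow_left₀ (by positivity) hle' 3) ?_
      rw [hU] at hg
      rcases hg with h | h
      · have h1 : (#G : ℝ) ≤ 8 * ((2 * τ) * (2 * τ)) := by
          refine h.trans ?_
          gcongr
        calc (#G : ℝ) ^ 3 ≤ (8 * ((2 * τ) * (2 * τ))) ^ 3 := by gcongr
          _ = 2 ^ 15 * (1 ^ 2 * τ ^ 2) * τ ^ 4 := by ring
          _ ≤ 2 ^ 15 * ((#A : ℝ) ^ 2 * (#A : ℝ) ^ 2) * τ ^ 4 := by gcongr
          _ = _ := by ring
      · calc (#G : ℝ) ^ 3 ≤ 512 * ((#A : ℝ) * #(XX A j) * (#(XX A i) * #(XX A j))) ^ 2 := h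
          _ ≤ 512 * ((#A : ℝ) * (2 * τ) * ((2 * τ) * (2 * τ))) ^ 2 := by gcongr
          _ = 2 ^ 15 * ((#A : ℝ) ^ 2 * τ ^ 2) * τ ^ 4 := by ring
          _ ≤ 2 ^ 15 * ((#A : ℝ) ^ 2 * (#A : ℝ) ^ 2) * τ ^ 4 := by gcongr
          _ = _ := by ring
    · have hg := gen_count (A.image (fun a => a⁻¹)) (XX A j) (XX A i) (A.image (fun a => a⁻¹))
        (l - i) (l - j) ((l - k) * y') (sub_ne_zero.2 hil.ne') (sub_ne_zero.2 (Ne.symm hjl))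
        (mul_ne_zero (sub_ne_zero.2 hkl.ne') hy0) hXi
      set G := {p ∈ (A.image (fun a => a⁻¹) ×ˢ XX A j) ×ˢ (XX A i ×ˢ A.image (fun a => a⁻¹)) |
        (l - i) * p.2.1 * p.1.1 + (l - j) * p.1.2 = (l - k) * y' * p.2.2} with hG
      have hle : #{w ∈ CC A i j k l | w.2.1 = y'} ≤ #G := by
        apply card_le_card_of_injOn (fun w => ((w.1.2.1⁻¹, w.1.2.2), (w.1.1, w.2.2.1⁻¹)))
        · rintro ⟨⟨y0, a0, x0⟩, ⟨y, a, x⟩⟩ h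
          simp only [CC, coe_filter, mem_filter, mem_product, Set.mem_ofPred_eq] at h
          simp only [hG, coe_filter, mem_product, Set.mem_ofPred_eq]
          refine ⟨⟨⟨mem_image_of_mem _ h.1.1.1.2.1, h.1.1.1.2.2⟩, h.1.1.1.1,
            mem_image_of_mem _ h.1.1.2.2.1⟩, ?_⟩
          have h1 := h.1.2.1
          have h2 := h.1.2.2
          have h3 := h.2
          subst h3
          rw [div_eq_mul_inv y0 a0, div_eq_mul_inv y a] at h1 h2
          linear_combination l * h1 - h2
        · rintro ⟨⟨y0, a0, x0⟩, ⟨y, a, x⟩⟩ h ⟨⟨y0', a0', x0'⟩, ⟨z, a', x'⟩⟩ h' heq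
          simp only [CC, coe_filter, mem_filter, mem_product, Set.mem_ofPred_eq] at h h'
          simp only [Prod.mk.injEq, inv_inj] at heq
          obtain ⟨⟨rfl, rfl⟩, rfl, rfl⟩ := heq
          obtain ⟨⟨hm, h1, -⟩, rfl⟩ := h
          obtain ⟨⟨hm', h1', -⟩, rfl⟩ := h'
          have : x = x' := by linarith
          rw [this]
      have hle' : (#{w ∈ CC A i j k l | w.2.1 = y'} : ℝ) ≤ #G := by exact_mod_cast hle
      refine le_trans (pow_le_pow_left₀ (by positivity) hle' 3) ?_
      rw [hU] at hg
      rcases hg with h | h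
      · have h1 : (#G : ℝ) ≤ 8 * ((2 * τ) * #A) := by
          refine h.trans ?_
          gcongr
        calc (#G : ℝ) ^ 3 ≤ (8 * ((2 * τ) * #A)) ^ 3 := by gcongr
          _ = 2 ^ 12 * ((#A : ℝ) ^ 3 * 1) * (τ ^ 3 * 1) := by ring
          _ ≤ 2 ^ 15 * ((#A : ℝ) ^ 3 * #A) * (τ ^ 3 * τ) := by gcongr <;> norm_num
          _ = _ := by ring
      · calc (#G : ℝ) ^ 3 ≤ 512 * ((#A : ℝ) * #(XX A j) * (#(XX A i) * #A)) ^ 2 := h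
          _ ≤ 512 * ((#A : ℝ) * (2 * τ) * ((2 * τ) * #A)) ^ 2 := by gcongr
          _ = 2 ^ 13 * (#A : ℝ) ^ 4 * τ ^ 4 := by ring
          _ ≤ _ := by gcongr <;> norm_num
  have hsum : (#(CC A i j k l) : ℝ) = ∑ y' ∈ XX A k, (#{w ∈ CC A i j k l | w.2.1 = y'} : ℝ) := by
    have := card_eq_sum_card_fiberwise (s := CC A i j k l) (t := XX A k) (f := fun w => w.2.1) (by
      intro w hw
      simp only [CC, coe_filter, mem_product, Set.mem_ofPred_eq] at hw
      exact hw.1.2.1)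
    exact_mod_cast this
  have hle : (#(CC A i j k l) : ℝ) ≤ (2 * τ) * B := by
    rw [hsum]
    calc ∑ y' ∈ XX A k, (#{w ∈ CC A i j k l | w.2.1 = y'} : ℝ) ≤ #(XX A k) • B :=
          sum_le_card_nsmul _ _ _ hfib
      _ = #(XX A k) * B := by rw [nsmul_eq_mul]
      _ ≤ _ := by gcongr
  calc (#(CC A i j k l) : ℝ) ^ 3 ≤ ((2 * τ) * B) ^ 3 := by gcongr
    _ = 8 * τ ^ 3 * B ^ 3 := by ring
    _ = _ := by rw [hB]; ring


lemma cluster (A Λ₁ Λ₂ : Finset ℝ) (hA : ∀ a ∈ A, 0 < a) (M : ℕ) (hM : 1 ≤ M)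
    (h1 : #Λ₁ = M) (h2 : #Λ₂ = M) (lo hi τ : ℝ) (hτ : 1 ≤ τ) (hτA : τ ≤ #A)
    (hM6 : (M : ℝ) ^ 6 * #A ≤ τ ^ 2)
    (hlt : ∀ i ∈ Λ₁, ∀ j ∈ Λ₂, i < j) (hlo : ∀ i ∈ Λ₁, lo ≤ i) (hhi : ∀ j ∈ Λ₂, j ≤ hi)
    (hX1 : ∀ i ∈ Λ₁, τ ≤ #(XX A i) ∧ (#(XX A i) : ℝ) ≤ 2 * τ)
    (hX2 : ∀ i ∈ Λ₂, τ ≤ #(XX A i) ∧ (#(XX A i) : ℝ) ≤ 2 * τ) :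
    (M : ℝ) ^ 2 * τ * #A ≤
      72 * #{z ∈ SS A ×ˢ SS A | 0 < z.1 ∧ lo * z.1 < z.2 ∧ z.2 < hi * z.1} := by
  set Z := {z ∈ SS A ×ˢ SS A | 0 < z.1 ∧ lo * z.1 < z.2 ∧ z.2 < hi * z.1} with hZ
  set T : Finset (Σ _ : ℝ × ℝ, ℝ × ℝ × ℝ) :=
    (Λ₁ ×ˢ Λ₂).sigma (fun p => XX A p.1 ×ˢ (A ×ˢ XX A p.2)) with hT
  set φ : (Σ _ : ℝ × ℝ, ℝ × ℝ × ℝ) → ℝ × ℝ := fun t =>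
    (t.2.1 / t.2.2.1 + t.2.2.2, t.1.1 * (t.2.1 / t.2.2.1) + t.1.2 * t.2.2.2) with hφ
  have hN0 : (1:ℝ) ≤ #A := hτ.trans hτA
  have himg : #(T.image φ) ≤ #Z := by
    apply card_le_card
    intro z hz
    obtain ⟨⟨⟨i, j⟩, ⟨y, a, x⟩⟩, ht, rfl⟩ := mem_image.1 hz
    simp only [hT, mem_sigma, mem_product] at ht
    obtain ⟨⟨hi', hj'⟩, hy, ha, hx⟩ := ht
    have hy' := mem_filter.1 hy
    have hx' := mem_filter.1 hx
    have y0 := hA _ hy'.1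
    have a0 := hA _ ha
    have x0 := hA _ hx'.1
    have hya : 0 < y / a := div_pos y0 a0
    have hij := hlt i hi' j hj'
    have hl := hlo i hi'
    have hh := hhi j hj'
    simp only [hZ, hφ, mem_filter, mem_product]
    refine ⟨⟨?_, ?_⟩, by positivity, ?_, ?_⟩
    · rw [add_comm]; exact mem_SS hy'.1 ha hx'.1
    · have : i * (y / a) + j * x = j * x + (i * y) / a := by ring
      rw [this]; exact mem_SS hy'.2 ha hx'.2
    · nlinarith
    · nlinarith
  have hTc : (M : ℝ) ^ 2 * (τ ^ 2 * #A) ≤ #T := by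
    rw [hT, card_sigma]
    push_cast
    calc (M : ℝ) ^ 2 * (τ ^ 2 * #A) = #(Λ₁ ×ˢ Λ₂) • (τ ^ 2 * #A : ℝ) := by
          rw [nsmul_eq_mul, card_product, h1, h2]; push_cast; ring
      _ ≤ _ := by
          apply card_nsmul_le_sum
          rintro ⟨i, j⟩ hp
          obtain ⟨hp1, hp2⟩ := mem_product.1 hp
          have e1 := (hX1 i hp1).1
          have e2 := (hX2 j hp2).1
          simp only [card_product]
          push_cast
          calc τ ^ 2 * (#A : ℝ) = τ * (#A * τ) := by ring
            _ ≤ _ := by gcongr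
  have hcoll : #{p ∈ T ×ˢ T | φ p.1 = φ p.2} =
      ∑ p ∈ Λ₁ ×ˢ Λ₂, ∑ q ∈ Λ₁ ×ˢ Λ₂, #(CC A p.1 p.2 q.1 q.2) := by
    rw [card_filter, sum_product, hT, sum_sigma]
    apply sum_congr rfl
    intro p _
    simp_rw [sum_sigma]
    rw [sum_comm]
    apply sum_congr rfl
    intro q _
    rw [CC, card_filter]
    refine Eq.trans ?_ (sum_product _ _ _).symm
    apply sum_congr rfl
    intro w _
    apply sum_congr rfl
    intro w' _
    simp only [hφ, Prod.mk.injEq]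
  have hM0 : (1:ℝ) ≤ M := by exact_mod_cast hM
  have hoff : ∀ p ∈ Λ₁ ×ˢ Λ₂, ∀ q ∈ Λ₁ ×ˢ Λ₂, p ≠ q →
      (#(CC A p.1 p.2 q.1 q.2) : ℝ) * M ^ 2 ≤ 64 * (#A * τ ^ 3) := by
    rintro ⟨i, j⟩ hp ⟨k, l⟩ hq hne
    obtain ⟨hp1, hp2⟩ := mem_product.1 hp
    obtain ⟨hq1, hq2⟩ := mem_product.1 hq
    have := coll_off A hA i j k l τ (hlt i hp1 j hp2) (hlt i hp1 l hq2) (hlt k hq1 j hp2)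
      (hlt k hq1 l hq2) (fun h => hne (by rw [h.1, h.2])) hτ hτA (hX1 i hp1).2 (hX2 j hp2).2
      (hX1 k hq1).2
    apply le_of_pow_le_pow_left₀ (n := 3) (by norm_num) (by positivity)
    calc ((#(CC A i j k l) : ℝ) * M ^ 2) ^ 3 = (#(CC A i j k l) : ℝ) ^ 3 * M ^ 6 := by ring
      _ ≤ (2 ^ 18 * (#A : ℝ) ^ 4 * τ ^ 7) * M ^ 6 := by gcongr
      _ = 2 ^ 18 * (#A : ℝ) ^ 3 * τ ^ 7 * (M ^ 6 * #A) := by ring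
      _ ≤ 2 ^ 18 * (#A : ℝ) ^ 3 * τ ^ 7 * τ ^ 2 := by gcongr
      _ = _ := by ring
  have hrow : ∀ p ∈ Λ₁ ×ˢ Λ₂, (∑ q ∈ Λ₁ ×ˢ Λ₂, (#(CC A p.1 p.2 q.1 q.2) : ℝ)) ≤
      72 * (#A * τ ^ 3) := by
    intro p hp
    rw [← add_sum_erase _ _ hp]
    obtain ⟨hp1, hp2⟩ := mem_product.1 hp
    have hd := coll_diag A hA p.1 p.2 τ (hlt _ hp1 _ hp2) (by linarith) (hX1 _ hp1).2 (hX2 _ hp2).2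
    have ho : (∑ q ∈ (Λ₁ ×ˢ Λ₂).erase p, (#(CC A p.1 p.2 q.1 q.2) : ℝ)) ≤ 64 * (#A * τ ^ 3) := by
      calc (∑ q ∈ (Λ₁ ×ˢ Λ₂).erase p, (#(CC A p.1 p.2 q.1 q.2) : ℝ))
          ≤ #((Λ₁ ×ˢ Λ₂).erase p) • (64 * (#A * τ ^ 3) / (M:ℝ) ^ 2) := by
            apply sum_le_card_nsmul
            intro q hq
            rw [le_div_iff₀ (by positivity)]
            exact hoff p hp q (mem_erase.1 hq).2 (mem_erase.1 hq).1.symm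
        _ ≤ (M:ℝ) ^ 2 * (64 * (#A * τ ^ 3) / (M:ℝ) ^ 2) := by
            rw [nsmul_eq_mul]
            gcongr
            have : #((Λ₁ ×ˢ Λ₂).erase p) ≤ M ^ 2 := by
              refine (card_erase_le).trans ?_
              rw [card_product, h1, h2, sq]
            exact_mod_cast this
        _ = _ := by field_simp
    linarith
  have hcoll' : (#{p ∈ T ×ˢ T | φ p.1 = φ p.2} : ℝ) ≤ M ^ 2 * (72 * (#A * τ ^ 3)) := by
    rw [hcoll]
    push_cast
    calc _ ≤ #(Λ₁ ×ˢ Λ₂) • (72 * (#A * τ ^ 3) : ℝ) := sum_le_card_nsmul _ _ _ hrow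
      _ = _ := by rw [nsmul_eq_mul, card_product, h1, h2]; push_cast; ring
  have hcs := cs_card T φ
  have hcs' : (#T : ℝ) ^ 2 ≤ #(T.image φ) * #{p ∈ T ×ˢ T | φ p.1 = φ p.2} := by exact_mod_cast hcs
  have himg' : (#(T.image φ) : ℝ) ≤ #Z := by exact_mod_cast himg
  have key : ((M : ℝ) ^ 2 * τ ^ 3 * #A) * ((M : ℝ) ^ 2 * τ * #A) ≤
      ((M : ℝ) ^ 2 * τ ^ 3 * #A) * (72 * #Z) := by
    calc ((M : ℝ) ^ 2 * τ ^ 3 * #A) * ((M : ℝ) ^ 2 * τ * #A) = ((M : ℝ) ^ 2 * (τ ^ 2 * #A)) ^ 2 := by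
          ring
      _ ≤ (#T : ℝ) ^ 2 := by gcongr
      _ ≤ _ := hcs'
      _ ≤ #Z * (M ^ 2 * (72 * (#A * τ ^ 3))) := by gcongr
      _ = _ := by ring
  exact le_of_mul_le_mul_left key (by positivity)


lemma part_two (A Λ : Finset ℝ) (hA : ∀ a ∈ A, 0 < a) (M : ℕ) (hM : 1 ≤ M) (hMΛ : 2 * M ≤ #Λ)
    (τ : ℝ) (hτ : 1 ≤ τ) (hτA : τ ≤ #A) (hM6 : (M : ℝ) ^ 6 * #A ≤ τ ^ 2)
    (hX : ∀ i ∈ Λ, τ ≤ #(XX A i) ∧ (#(XX A i) : ℝ) ≤ 2 * τ) :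
    (M : ℝ) * #Λ * τ * #A ≤ 288 * (#(SS A) : ℝ) ^ 2 := by
  set f := Λ.orderEmbOfFin rfl with hf
  set g : ℕ → ℝ := fun n => if h : n < #Λ then f ⟨n, h⟩ else 0 with hg
  have hgm : ∀ n, n < #Λ → g n ∈ Λ := by
    intro n hn
    simp only [hg, hn, dite_true]
    exact orderEmbOfFin_mem _ _ _
  have hglt : ∀ m n, m < n → n < #Λ → g m < g n := by
    intro m n hmn hn
    have hm := hmn.trans hn
    simp only [hg, hn, hm, dite_true]
    exact f.strictMono hmn
  have hgle : ∀ m n, m ≤ n → n < #Λ → g m ≤ g n := by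
    intro m n hmn hn
    rcases hmn.eq_or_lt with h | h
    · rw [h]
    · exact (hglt m n h hn).le
  have hginj : ∀ m n, m < #Λ → n < #Λ → g m = g n → m = n := by
    intro m n hm hn h
    rcases lt_trichotomy m n with h' | h' | h'
    · exact absurd h (hglt m n h' hn).ne
    · exact h'
    · exact absurd h (hglt n m h' hm).ne'
  set Q := #Λ / (2 * M) with hQ
  have hQ1 : 1 ≤ Q := (Nat.one_le_div_iff (by omega)).2 hMΛ
  have hQle : Q * (2 * M) ≤ #Λ := Nat.div_mul_le_self _ _
  have hQlt : #Λ < (Q + 1) * (2 * M) := by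
    rw [hQ, mul_comm]; exact Nat.lt_mul_div_succ _ (by omega)
  have hkQ : ∀ k, k < Q → k * (2 * M) + 2 * M ≤ #Λ := by
    intro k hk
    have : (k + 1) * (2 * M) ≤ Q * (2 * M) := Nat.mul_le_mul_right _ hk
    linarith [this, add_one_mul k (2 * M)]
  set Z : ℕ → Finset (ℝ × ℝ) := fun k => {z ∈ SS A ×ˢ SS A | 0 < z.1 ∧
    g (k * (2 * M)) * z.1 < z.2 ∧ z.2 < g (k * (2 * M) + (2 * M - 1)) * z.1} with hZ
  have hdisj : ∀ k k', k < k' → k' < Q → Disjoint (Z k) (Z k') := by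
    intro k k' hkk hk'
    rw [disjoint_left]
    intro z hz hz'
    simp only [hZ, mem_filter] at hz hz'
    have h1 := hkQ k' hk'
    have h2 : (k + 1) * (2 * M) ≤ k' * (2 * M) := Nat.mul_le_mul_right _ hkk
    rw [add_one_mul] at h2
    have h3 : g (k * (2 * M) + (2 * M - 1)) ≤ g (k' * (2 * M)) := hgle _ _ (by omega) (by omega)
    nlinarith [hz.2.1, hz.2.2.2, hz'.2.2.1]
  have hcl : ∀ k ∈ range Q, (M : ℝ) ^ 2 * τ * #A / 72 ≤ #(Z k) := by
    intro k hk
    have hk := hkQ k (mem_range.1 hk)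
    set b := k * (2 * M) with hb
    have := cluster A ((range M).image (fun r => g (b + r)))
      ((range M).image (fun r => g (b + M + r))) hA M hM
      (by
        rw [card_image_of_injOn, card_range]
        intro r hr r' hr' h
        have hr := mem_range.1 hr
        have hr' := mem_range.1 hr'
        have := hginj _ _ (by omega) (by omega) h
        omega)
      (by
        rw [card_image_of_injOn, card_range]
        intro r hr r' hr' h
        have hr := mem_range.1 hr
        have hr' := mem_range.1 hr'
        have := hginj _ _ (by omega) (by omega) h
        omega)
      (g b) (g (b + (2 * M - 1))) τ hτ hτA hM6
      (by
        intro i hi j hj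
        obtain ⟨r, hr, rfl⟩ := mem_image.1 hi
        obtain ⟨r', hr', rfl⟩ := mem_image.1 hj
        have hr := mem_range.1 hr
        have hr' := mem_range.1 hr'
        exact hglt _ _ (by omega) (by omega))
      (by
        intro i hi
        obtain ⟨r, hr, rfl⟩ := mem_image.1 hi
        have hr := mem_range.1 hr
        exact hgle _ _ (by omega) (by omega))
      (by
        intro i hi
        obtain ⟨r, hr, rfl⟩ := mem_image.1 hi
        have hr := mem_range.1 hr
        exact hgle _ _ (by omega) (by omega))
      (by
        intro i hi
        obtain ⟨r, hr, rfl⟩ := mem_image.1 hi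
        have hr := mem_range.1 hr
        exact hX _ (hgm _ (by omega)))
      (by
        intro i hi
        obtain ⟨r, hr, rfl⟩ := mem_image.1 hi
        have hr := mem_range.1 hr
        exact hX _ (hgm _ (by omega)))
    rw [div_le_iff₀ (by norm_num), mul_comm _ (72:ℝ)]
    exact this
  have hsum : ∑ k ∈ range Q, #(Z k) ≤ #(SS A) ^ 2 := by
    rw [← card_biUnion, sq, ← card_product]
    · apply card_le_card
      intro z hz
      obtain ⟨k, -, hk⟩ := mem_biUnion.1 hz
      exact (mem_filter.1 hk).1
    · intro k hk k' hk' hne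
      rcases lt_or_gt_of_ne hne with h | h
      · exact hdisj k k' h (mem_range.1 hk')
      · exact (hdisj k' k h (mem_range.1 hk)).symm
  have hsum' : ∑ k ∈ range Q, (#(Z k) : ℝ) ≤ (#(SS A) : ℝ) ^ 2 := by exact_mod_cast hsum
  have hsum2 : (Q : ℝ) * ((M : ℝ) ^ 2 * τ * #A / 72) ≤ (#(SS A) : ℝ) ^ 2 := by
    refine le_trans ?_ hsum'
    have := card_nsmul_le_sum _ _ _ hcl
    rwa [nsmul_eq_mul, card_range] at this
  have hQ4 : #Λ ≤ 4 * M * Q := by nlinarith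
  have hQ4' : (#Λ : ℝ) ≤ 4 * M * Q := by exact_mod_cast hQ4
  calc (M : ℝ) * #Λ * τ * #A ≤ M * (4 * M * Q) * τ * #A := by gcongr
    _ = 288 * (Q * ((M : ℝ) ^ 2 * τ * #A / 72)) := by ring
    _ ≤ _ := by gcongr


lemma pigeon (A : Finset ℝ) (hA : ∀ a ∈ A, 0 < a) (hAn : A.Nonempty) :
    ∃ (Λ : Finset ℝ) (τ : ℝ), Λ.Nonempty ∧ (∀ l ∈ Λ, 0 < l) ∧ #Λ ≤ #A ^ 2 ∧ 1 ≤ τ ∧ τ ≤ #A ∧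
      (∀ l ∈ Λ, τ ≤ #(XX A l) ∧ (#(XX A l) : ℝ) ≤ 2 * τ) ∧
      (#A : ℝ) ^ 2 ≤ ((Nat.log 2 #A + 1 : ℕ) : ℝ) * (#Λ * (2 * τ)) := by
  set R := (A ×ˢ A).image (fun p => p.2 / p.1) with hR
  have hpos : ∀ l ∈ R, 0 < l := by
    intro l hl
    obtain ⟨p, hp, rfl⟩ := mem_image.1 hl
    have := mem_product.1 hp
    exact div_pos (hA _ this.2) (hA _ this.1)
  have hXn : ∀ l ∈ R, 0 < #(XX A l) := by
    intro l hl
    obtain ⟨p, hp, rfl⟩ := mem_image.1 hl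
    have := mem_product.1 hp
    refine card_pos.2 ⟨p.1, mem_filter.2 ⟨this.1, ?_⟩⟩
    rw [div_mul_cancel₀ _ (hA _ this.1).ne']
    exact this.2
  have hXle : ∀ l, #(XX A l) ≤ #A := fun l => card_le_card (XX_sub A l)
  have hsum : #A ^ 2 ≤ ∑ l ∈ R, #(XX A l) := by
    rw [sq, ← card_product, card_eq_sum_card_image (fun p : ℝ × ℝ => p.2 / p.1) (A ×ˢ A)]
    apply sum_le_sum
    intro l hl
    apply card_le_card_of_injOn (fun p => p.1)
    · rintro ⟨b, a⟩ h
      simp only [coe_filter, mem_product, Set.mem_ofPred_eq] at h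
      obtain ⟨⟨hb, ha⟩, rfl⟩ := h
      refine mem_coe.2 (mem_filter.2 ⟨hb, ?_⟩)
      rw [div_mul_cancel₀ _ (hA _ hb).ne']
      exact ha
    · rintro ⟨b, a⟩ h ⟨b', a'⟩ h' heq
      simp only [coe_filter, mem_product, Set.mem_ofPred_eq] at h h'
      simp only at heq
      subst heq
      have hb := (hA _ h.1.1).ne'
      have he : a / b = a' / b := h.2.trans h'.2.symm
      have : a = a' := by
        rwa [div_left_inj' hb] at he
      rw [this]
  set J := Nat.log 2 #A + 1 with hJ
  have hmaps : ∀ l ∈ R, Nat.log 2 #(XX A l) ∈ range J := by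
    intro l hl
    rw [mem_range, hJ, Nat.lt_succ_iff]
    exact Nat.log_mono_right (hXle l)
  rw [← sum_fiberwise_of_maps_to hmaps] at hsum
  obtain ⟨s, hs, hs2⟩ : ∃ s ∈ range J, #A ^ 2 ≤
      J * ∑ l ∈ R with Nat.log 2 #(XX A l) = s, #(XX A l) := by
    by_contra hcon
    push Not at hcon
    have h1 : ∑ s ∈ range J, (J * ∑ l ∈ R with Nat.log 2 #(XX A l) = s, #(XX A l)) <
        ∑ s ∈ range J, #A ^ 2 := sum_lt_sum_of_nonempty ⟨0, by simp [hJ]⟩ hcon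
    rw [← mul_sum, sum_const, card_range, smul_eq_mul] at h1
    have := Nat.lt_of_mul_lt_mul_left h1
    omega
  have hA0 : 0 < #A := hAn.card_pos
  have hXb : ∀ l ∈ {l ∈ R | Nat.log 2 #(XX A l) = s}, 2 ^ s ≤ #(XX A l) ∧ #(XX A l) ≤ 2 * 2 ^ s := by
    intro l hl
    obtain ⟨hlR, rfl⟩ := mem_filter.1 hl
    refine ⟨Nat.pow_log_le_self 2 (hXn l hlR).ne', ?_⟩
    have := Nat.lt_pow_succ_log_self (b := 2) (by norm_num) #(XX A l)
    rw [pow_succ] at this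
    omega
  have hne : ({l ∈ R | Nat.log 2 #(XX A l) = s}).Nonempty := by
    rw [nonempty_iff_ne_empty]
    intro h
    rw [h, sum_empty, mul_zero] at hs2
    have : 0 < #A ^ 2 := by positivity
    omega
  refine ⟨{l ∈ R | Nat.log 2 #(XX A l) = s}, 2 ^ s, hne, fun l hl => hpos l (mem_filter.1 hl).1,
    ?_, one_le_pow₀ (by norm_num), ?_, ?_, ?_⟩
  · refine (card_filter_le _ _).trans (card_image_le.trans ?_)
    rw [card_product, sq]
  · obtain ⟨l, hl⟩ := hne
    have := (hXb l hl).1.trans (hXle l)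
    exact_mod_cast this
  · intro l hl
    have := hXb l hl
    exact ⟨by exact_mod_cast this.1, by exact_mod_cast this.2⟩
  · have h1 : ∑ l ∈ R with Nat.log 2 #(XX A l) = s, #(XX A l) ≤
        #{l ∈ R | Nat.log 2 #(XX A l) = s} * (2 * 2 ^ s) := by
      rw [← smul_eq_mul]
      exact sum_le_card_nsmul _ _ _ (fun l hl => (hXb l hl).2)
    have h2 := hs2.trans (Nat.mul_le_mul_left J h1)
    exact_mod_cast h2

lemma log_J (n : ℕ) (hn : 1 ≤ n) :
    Real.log ((Nat.log 2 n + 1 : ℕ) : ℝ) ≤ Real.log 2001 + 1 / 1000 * Real.log n := by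
  have hn' : (1:ℝ) ≤ n := by exact_mod_cast hn
  have h0 : (0:ℝ) < n := by linarith
  have h1 : (Nat.log 2 n : ℝ) ≤ 2 * Real.log n := by
    have h := Nat.pow_log_le_self 2 (x := n) (by omega)
    have h' : (2:ℝ) ^ (Nat.log 2 n) ≤ n := by exact_mod_cast h
    have h2 := Real.log_le_log (by positivity) h'
    rw [Real.log_pow] at h2
    have := Real.log_two_gt_d9
    have h3 : (0:ℝ) ≤ Nat.log 2 n := by positivity
    nlinarith
  have h2 : Real.log n ≤ (n:ℝ) ^ (1/1000 : ℝ) / (1/1000) := Real.log_le_rpow_div h0.le (by norm_num)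
  have h3 : (1:ℝ) ≤ (n:ℝ) ^ (1/1000 : ℝ) := Real.one_le_rpow hn' (by norm_num)
  have h4 : ((Nat.log 2 n + 1 : ℕ) : ℝ) ≤ 2001 * (n:ℝ) ^ (1/1000 : ℝ) := by
    push_cast
    rw [div_eq_mul_inv] at h2
    norm_num at h2 h3 ⊢
    linarith
  calc _ ≤ Real.log (2001 * (n:ℝ) ^ (1/1000 : ℝ)) := Real.log_le_log (by positivity) h4
    _ = _ := by
      rw [Real.log_mul (by norm_num) (by positivity), Real.log_rpow h0]

lemma log_bound (A : Finset ℝ) (hA : ∀ a ∈ A, 0 < a) (hAn : 2 ≤ #A) :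
    20 / 13 * Real.log #A ≤ Real.log #(SS A) + 10 * (Real.log 2001 + Real.log 2 + Real.log 128 +
      Real.log 3072 + Real.log 61440 + Real.log 4096 + Real.log 288) := by
  have hne : A.Nonempty := card_pos.1 (by omega)
  have hS : (1:ℝ) ≤ #(SS A) := by
    obtain ⟨a, ha⟩ := hne
    have : 0 < #(SS A) := card_pos.2 ⟨_, mem_SS ha ha ha⟩
    exact_mod_cast this
  have hσ : 0 ≤ Real.log #(SS A) := Real.log_nonneg hS
  have c1 : 0 ≤ Real.log 2001 := Real.log_nonneg (by norm_num)
  have c2 : 0 ≤ Real.log 2 := Real.log_nonneg (by norm_num)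
  have c3 : 0 ≤ Real.log 128 := Real.log_nonneg (by norm_num)
  have c4 : 0 ≤ Real.log 3072 := Real.log_nonneg (by norm_num)
  have c5 : 0 ≤ Real.log 61440 := Real.log_nonneg (by norm_num)
  have c6 : 0 ≤ Real.log 4096 := Real.log_nonneg (by norm_num)
  have c7 : 0 ≤ Real.log 288 := Real.log_nonneg (by norm_num)
  by_cases hbig : Real.log #A ≤ 4 * (Real.log 2001 + Real.log 2) + Real.log 128
  · linarith
  push Not at hbig
  have hN1 : (1:ℝ) ≤ #A := by exact_mod_cast (by omega : 1 ≤ #A)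
  have hN0 : (0:ℝ) < #A := by linarith
  have h128 : 128 ≤ #A := by
    by_contra h
    have h' : (#A : ℝ) ≤ 128 := by exact_mod_cast (by omega : #A ≤ 128)
    have := Real.log_le_log hN0 h'
    linarith
  obtain ⟨Λ, τ, hΛn, hΛp, hΛc, hτ, hτA, hX, hP⟩ := pigeon A hA hne
  have hK1 : (1:ℝ) ≤ #Λ := by exact_mod_cast hΛn.card_pos
  have hJ := log_J #A (by omega)
  set n := Real.log #A with hn
  set σ := Real.log #(SS A) with hσd
  set k := Real.log #Λ with hk
  have hk0 : 0 ≤ k := Real.log_nonneg hK1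
  have hP' : 2 * n ≤ Real.log 2001 + 1 / 1000 * n + (k + (Real.log 2 + Real.log τ)) := by
    have h := Real.log_le_log (by positivity) hP
    rw [Real.log_pow, Real.log_mul (by positivity) (by positivity),
      Real.log_mul (by positivity) (by positivity), Real.log_mul (by positivity) (by positivity)] at h
    push_cast at h hJ
    linarith
  by_cases hτc : Real.log τ ≤ 3 / 4 * n
  · obtain ⟨t, ht0, ht⟩ : ∃ t : ℝ, 0 < t ∧ 4096 * t ^ 5 = (#A : ℝ) ^ 4 * τ ^ 2 := by
      refine ⟨((#A : ℝ) ^ 4 * τ ^ 2 / 4096) ^ ((1:ℝ) / 5), by positivity, ?_⟩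
      rw [← Real.rpow_natCast (_ ^ _) 5, ← Real.rpow_mul (by positivity)]
      norm_num
      ring
    have hlt : Real.log 4096 + 5 * Real.log t = 4 * n + 2 * Real.log τ := by
      have := congrArg Real.log ht
      rw [Real.log_mul (by positivity) (by positivity),
        Real.log_mul (by positivity) (by positivity), Real.log_pow, Real.log_pow, Real.log_pow] at this
      exact_mod_cast this
    rcases part_one A Λ hA hΛp hΛn hΛc τ t hτ (fun l hl => (hX l hl).1) h128 ht0 ht with h | h
    · have h := Real.log_le_log (by positivity) h
      rw [Real.log_mul (by positivity) (by positivity),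
        Real.log_mul (by positivity) (by positivity), Real.log_pow, Real.log_pow] at h
      push_cast at h
      linarith
    · have h := Real.log_le_log (by positivity) h
      rw [Real.log_mul (by positivity) (by positivity),
        Real.log_mul (by positivity) (by positivity),
        Real.log_mul (by positivity) (by positivity),
        Real.log_mul (by positivity) (by positivity), Real.log_pow, Real.log_pow,
        Real.log_sqrt (by positivity)] at h
      push_cast at h
      linarith
  · push Not at hτc
    set M := ⌊(#A : ℝ) ^ ((1:ℝ) / 12)⌋₊ with hM
    have hx1 : (1:ℝ) ≤ (#A : ℝ) ^ ((1:ℝ) / 12) := Real.one_le_rpow hN1 (by norm_num)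
    have hM1 : 1 ≤ M := Nat.le_floor (by exact_mod_cast hx1)
    have hM1' : (1:ℝ) ≤ M := by exact_mod_cast hM1
    have hMle : (M:ℝ) ≤ (#A : ℝ) ^ ((1:ℝ) / 12) := Nat.floor_le (by positivity)
    have hMge : (#A : ℝ) ^ ((1:ℝ) / 12) ≤ M * 2 := by
      have := Nat.lt_floor_add_one ((#A : ℝ) ^ ((1:ℝ) / 12))
      linarith
    have hm1 : Real.log M ≤ 1 / 12 * n := by
      have := Real.log_le_log (by positivity) hMle
      rwa [Real.log_rpow hN0] at this
    have hm2 : 1 / 12 * n ≤ Real.log M + Real.log 2 := by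
      have := Real.log_le_log (by positivity) hMge
      rwa [Real.log_rpow hN0, Real.log_mul (by positivity) (by positivity)] at this
    have hτn : Real.log τ ≤ n := Real.log_le_log (by positivity) hτA
    have hMΛ : 2 * M ≤ #Λ := by
      by_contra h
      have h' : (#Λ : ℝ) ≤ 2 * M := by exact_mod_cast (by omega : #Λ ≤ 2 * M)
      have h2 := Real.log_le_log (by positivity) h'
      rw [Real.log_mul (by positivity) (by positivity)] at h2
      linarith
    have hM6 : (M : ℝ) ^ 6 * #A ≤ τ ^ 2 := by
      rw [← Real.log_le_log_iff (by positivity) (by positivity),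
        Real.log_mul (by positivity) (by positivity), Real.log_pow, Real.log_pow]
      push_cast
      linarith
    have h := part_two A Λ hA M hM1 hMΛ τ hτ hτA hM6 hX
    have h := Real.log_le_log (by positivity) h
    rw [Real.log_mul (by positivity) (by positivity), Real.log_mul (by positivity) (by positivity),
      Real.log_mul (by positivity) (by positivity),
      Real.log_mul (by positivity) (by positivity), Real.log_pow] at h
    push_cast at h
    linarith

theorem ratio_sumset_lower_bound :
    ∃ c : ℝ, 0 < c ∧ ∀ A : Finset ℝ, (∀ a ∈ A, 0 < a) → 2 ≤ A.card →
      c * (A.card : ℝ) ^ ((3 : ℝ) / 2 + 1 / 26) / Real.log A.card ^ ((5 : ℝ) / 6) ≤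
        ((Finset.image₂ (· + ·) (Finset.image₂ (· / ·) A A) A).card : ℝ) := by
  set C := 10 * (Real.log 2001 + Real.log 2 + Real.log 128 +
      Real.log 3072 + Real.log 61440 + Real.log 4096 + Real.log 288) with hC
  have hl2 : 0 < Real.log 2 := Real.log_pos (by norm_num)
  refine ⟨Real.log 2 ^ ((5:ℝ) / 6) * Real.exp (-C), by positivity, ?_⟩
  intro A hA hA2
  have hb := log_bound A hA hA2
  rw [← hC] at hb
  have hN2 : (2:ℝ) ≤ #A := by exact_mod_cast hA2
  have hlog : Real.log 2 ≤ Real.log #A := Real.log_le_log (by norm_num) hN2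
  have hS : (0:ℝ) < #(SS A) := by
    obtain ⟨a, ha⟩ := card_pos.1 (by omega : 0 < #A)
    exact_mod_cast card_pos.2 ⟨_, mem_SS ha ha ha⟩
  have hmain : Real.exp (-C) * (#A : ℝ) ^ ((3 : ℝ) / 2 + 1 / 26) ≤ #(SS A) := by
    rw [← Real.log_le_log_iff (by positivity) hS, Real.log_mul (by positivity) (by positivity),
      Real.log_exp, Real.log_rpow (by positivity)]
    norm_num
    linarith
  change _ ≤ (#(SS A) : ℝ)
  have hlp : 0 < Real.log #A := by linarith
  rw [div_le_iff₀ (by positivity)]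
  calc Real.log 2 ^ ((5:ℝ) / 6) * Real.exp (-C) * (#A : ℝ) ^ ((3 : ℝ) / 2 + 1 / 26)
      = (Real.exp (-C) * (#A : ℝ) ^ ((3 : ℝ) / 2 + 1 / 26)) * Real.log 2 ^ ((5:ℝ) / 6) := by ring
    _ ≤ #(SS A) * Real.log #A ^ ((5:ℝ) / 6) := by gcongr
end

section
/- For finite sets A, B of positive real numbers, |AB + A| ≫ |A|·|B|^{1/2}: there is an absolute constant c > 0 such that |{ab + a' : a,a' ∈ A, b ∈ B}| ≥ c·|A|·|B|^{1/2}. -/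
open Finset

lemma balog_count (A B : Finset ℝ) (hA : A.Nonempty)
    (hA0 : ∀ a ∈ A, 0 < a) (hB0 : ∀ b ∈ B, 0 < b) :
    B.card * (A.card * A.card - 1) ≤
      (Finset.image₂ (· + ·) (Finset.image₂ (· * ·) A B) A).card *
      (Finset.image₂ (· + ·) (Finset.image₂ (· * ·) A B) A).card := by
  classical
  set T := Finset.image₂ (· + ·) (Finset.image₂ (· * ·) A B) A with hT
  have hTm : ∀ a ∈ A, ∀ b ∈ B, ∀ a' ∈ A, a * b + a' ∈ T := fun a ha b hb a' ha' =>
    Finset.mem_image₂_of_mem (Finset.mem_image₂_of_mem ha hb) ha'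
  obtain ⟨M, hM, hMmax⟩ := A.exists_max_image id hA
  obtain ⟨m, hm, hmmin⟩ := A.exists_min_image id hA
  simp only [id] at hMmax hmmin
  set S := (A ×ˢ A).erase (M, m) with hS
  have hScard : S.card = A.card * A.card - 1 := by
    rw [hS, Finset.card_erase_of_mem (by simp [hM, hm]), Finset.card_product]
  have hex : ∀ t : ℝ, ∃ q : ℝ × ℝ, (∃ p ∈ S, p.2 / p.1 = t) →
      q ∈ A ×ˢ A ∧ q.2 / q.1 < t ∧ ∀ r ∈ A ×ˢ A, r.2 / r.1 < t → r.2 / r.1 ≤ q.2 / q.1 := by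
    intro t
    by_cases h : ∃ p ∈ S, p.2 / p.1 = t
    · obtain ⟨⟨x, y⟩, hp, rfl⟩ := h
      rw [hS, Finset.mem_erase, Finset.mem_product] at hp
      obtain ⟨hne, hx, hy⟩ := hp
      simp only at hx hy
      have hlt : m / M < y / x := by
        rw [div_lt_div_iff₀ (hA0 _ hM) (hA0 _ hx)]
        have h1 := hMmax x hx
        have h2 := hmmin y hy
        have h3 := hA0 _ hm
        have h4 := hA0 _ hM
        rcases h1.lt_or_eq with h | h
        · nlinarith
        · rcases h2.lt_or_eq with h' | h'
          · nlinarith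
          · exact absurd (by rw [h, h']) hne
      obtain ⟨q, hq, hqmax⟩ := ((A ×ˢ A).filter (fun r => r.2 / r.1 < y / x)).exists_max_image
        (fun r => r.2 / r.1) ⟨(M, m), by simp [hM, hm, hlt]⟩
      rw [Finset.mem_filter] at hq
      exact ⟨q, fun _ => ⟨hq.1, hq.2, fun r hr hr' => hqmax r (by
        rw [Finset.mem_filter]; exact ⟨hr, hr'⟩)⟩⟩
    · exact ⟨0, fun h' => absurd h' h⟩
  choose f hf using hex
  rw [← hScard, ← Finset.card_product, ← Finset.card_product]
  apply Finset.card_le_card_of_injOn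
    (fun z : ℝ × (ℝ × ℝ) => ((f (z.2.2 / z.2.1)).1 * z.1 + z.2.1,
      (f (z.2.2 / z.2.1)).2 * z.1 + z.2.2))
  · rintro ⟨b, x, y⟩ hz
    simp only [Finset.coe_product, Set.mem_prod, Finset.mem_coe] at hz ⊢
    have h1 := (hf (y / x) ⟨(x, y), hz.2, rfl⟩).1
    have h2 := Finset.mem_of_mem_erase hz.2
    rw [Finset.mem_product] at h1 h2
    exact ⟨hTm _ h1.1 _ hz.1 _ h2.1, hTm _ h1.2 _ hz.1 _ h2.2⟩
  · -- the image lies strictly between the two rays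
    have key : ∀ b ∈ B, ∀ x y : ℝ, (x, y) ∈ S →
        0 < x ∧ 0 < (f (y / x)).1 ∧ 0 < (f (y / x)).1 * b + x ∧
        (f (y / x)).2 / (f (y / x)).1 <
          ((f (y / x)).2 * b + y) / ((f (y / x)).1 * b + x) ∧
        ((f (y / x)).2 * b + y) / ((f (y / x)).1 * b + x) < y / x := by
      intro b hb x y hp
      obtain ⟨h1, h2, -⟩ := hf (y / x) ⟨(x, y), hp, rfl⟩
      have h3 := Finset.mem_of_mem_erase hp
      rw [Finset.mem_product] at h1 h3
      have hx := hA0 _ h3.1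
      have hu := hA0 _ h1.1
      have hb0 := hB0 _ hb
      simp only at hx
      have hs : 0 < (f (y / x)).1 * b + x := by positivity
      generalize f (y / x) = q at *
      have h4 := (div_lt_div_iff₀ hu hx).1 h2
      refine ⟨hx, hu, hs, ?_, ?_⟩
      · rw [div_lt_div_iff₀ hu hs]; nlinarith
      · rw [div_lt_div_iff₀ hs hx]; nlinarith
    rintro ⟨b, x, y⟩ hz ⟨b', x', y'⟩ hz' heq
    simp only [Finset.coe_product, Set.mem_prod, Finset.mem_coe] at hz hz'
    simp only [Prod.mk.injEq] at heq
    obtain ⟨hx, hu, hs, k1, k2⟩ := key b hz.1 x y hz.2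
    obtain ⟨hx', hu', hs', k1', k2'⟩ := key b' hz'.1 x' y' hz'.2
    obtain ⟨-, g2, g3⟩ := hf (y / x) ⟨(x, y), hz.2, rfl⟩
    obtain ⟨-, g2', g3'⟩ := hf (y' / x') ⟨(x', y'), hz'.2, rfl⟩
    have hsl : y / x = y' / x' := by
      rcases lt_trichotomy (y / x) (y' / x') with h | h | h
      · have := g3' (x, y) (Finset.mem_of_mem_erase hz.2) h
        rw [heq.1, heq.2] at k2
        simp only at this
        linarith
      · exact h
      · have := g3 (x', y') (Finset.mem_of_mem_erase hz'.2) h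
        rw [heq.1, heq.2] at k1
        simp only at this
        linarith
    rw [← hsl] at heq hu' g2'
    obtain ⟨e1, e2⟩ := heq
    generalize f (y / x) = q at *
    rw [div_eq_div_iff hx.ne' hx'.ne'] at hsl
    have h4 := (div_lt_div_iff₀ hu hx).1 g2
    have hbb : b = b' := by
      have : (q.2 * x - y * q.1) * (b - b') = 0 := by
        have hxx : x * (x * y' - y * x') = 0 := by rw [show x * y' = y * x' by linarith]; ring
        have : x * y' = y * x' := by linarith
        linear_combination x * e2 - y * e1 + this
      rcases mul_eq_zero.1 this with h | h <;> linarith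
    subst hbb
    have hxx : x = x' := by linarith
    have hyy : y = y' := by linarith
    rw [hxx, hyy]

theorem balog_AB_plus_A :
    ∃ c : ℝ, 0 < c ∧ ∀ A B : Finset ℝ, A.Nonempty → B.Nonempty →
      (∀ a ∈ A, 0 < a) → (∀ b ∈ B, 0 < b) →
      c * (A.card : ℝ) * (B.card : ℝ) ^ ((1 : ℝ) / 2) ≤
        ((Finset.image₂ (· + ·) (Finset.image₂ (· * ·) A B) A).card : ℝ) := by
  refine ⟨1 / 2, by norm_num, fun A B hA hB hA0 hB0 => ?_⟩
  have hc := balog_count A B hA hA0 hB0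
  have hB1 : (1 : ℝ) ≤ B.card := by exact_mod_cast hB.card_pos
  have hsq : (1 / 2 * (A.card : ℝ) * (B.card : ℝ) ^ ((1 : ℝ) / 2)) ^ 2
      = 1 / 4 * ((A.card : ℝ) * A.card) * B.card := by
    rw [← Real.sqrt_eq_rpow, mul_pow, Real.sq_sqrt (by positivity)]; ring
  refine (pow_le_pow_iff_left₀ (by positivity) (by positivity) two_ne_zero).1 ?_
  rw [hsq]
  rcases Nat.lt_or_ge 1 A.card with h | h
  · have h1 : 1 ≤ A.card * A.card := by nlinarith
    have h2 : (B.card : ℝ) * ((A.card : ℝ) * A.card - 1) ≤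
      ((Finset.image₂ (· + ·) (Finset.image₂ (· * ·) A B) A).card : ℝ) *
      (Finset.image₂ (· + ·) (Finset.image₂ (· * ·) A B) A).card := by
      have := (Nat.cast_le (α := ℝ)).2 hc
      push_cast [Nat.cast_sub h1] at this
      exact this
    have h3 : (2 : ℝ) ≤ A.card := by exact_mod_cast h
    have h4 : (A.card : ℝ) * A.card * (1 / 4) ≤ (A.card : ℝ) * A.card - 1 := by nlinarith
    nlinarith [mul_le_mul_of_nonneg_left h4 (by linarith : (0 : ℝ) ≤ B.card)]
  · have h1 : A.card = 1 := le_antisymm h hA.card_pos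
    obtain ⟨a, rfl⟩ := Finset.card_eq_one.1 h1
    have ha := hA0 a (by simp)
    have h2 : B.card ≤
        (Finset.image₂ (· + ·) (Finset.image₂ (· * ·) {a} B) {a}).card := by
      apply Finset.card_le_card_of_injOn (fun b => a * b + a)
      · intro b hb
        exact Finset.mem_image₂_of_mem (Finset.mem_image₂_of_mem (by simp) hb) (by simp)
      · intro b _ b' _ h
        simpa [ha.ne'] using h
    have h3 := (Nat.cast_le (α := ℝ)).2 h2
    simp only [Finset.card_singleton, Nat.cast_one]
    nlinarith
end

section
/- Let P be a finite set of points and L a finite set of lines in ℝ². Then the number of incidences |{(p, ℓ) ∈ P × L : p ∈ ℓ}| ≤ C((|P||L|)^{2/3} + |P| + |L|) for an absolute constant C (Szemerédi–Trotter theorem). -/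
open Finset

/-- A point `p` lies on the line with equation `a*x + b*y = c`, encoded by the
triple `(a, b, c)`. -/
def OnLine (p : ℝ × ℝ) (l : ℝ × ℝ × ℝ) : Prop :=
  l.1 * p.1 + l.2.1 * p.2 = l.2.2

namespace ST

/-- A segment of the graph of `x ↦ m * x + c` above the interval `[a, b]`. -/
@[ext] structure Edge where
  m : ℝ
  c : ℝ
  a : ℝ
  b : ℝ

/-- Height of the supporting line. -/
def Edge.y (e : Edge) (x : ℝ) : ℝ := e.m * x + e.c

/-- Left endpoint. -/
def Edge.src (e : Edge) : ℝ × ℝ := (e.a, e.y e.a)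

/-- Right endpoint. -/
def Edge.tgt (e : Edge) : ℝ × ℝ := (e.b, e.y e.b)

theorem card_le_of_rel {α β : Type*} (A : Finset α) (B : Finset β) (R : α → β → Prop)
    (h1 : ∀ a ∈ A, ∃ b ∈ B, R a b)
    (h2 : ∀ a ∈ A, ∀ a' ∈ A, ∀ b ∈ B, R a b → R a' b → a = a') : A.card ≤ B.card := by
  classical
  rcases A.eq_empty_or_nonempty with hA | ⟨a0, ha0⟩
  · simp [hA]
  obtain ⟨b0, -, -⟩ := h1 a0 ha0
  have : Nonempty β := ⟨b0⟩
  choose! f hf hR using h1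
  refine Finset.card_le_card_of_injOn f (fun a ha => hf a ha) ?_
  intro a ha a' ha' h
  refine h2 a ha a' ha' (f a) (hf a ha) (hR a ha) ?_
  rw [h]
  exact hR a' ha'

/-- Two edges meeting at a common interior abscissa. -/
def Meet (e g : Edge) : Prop :=
  ∃ x, e.a < x ∧ x < e.b ∧ g.a < x ∧ x < g.b ∧ e.y x = g.y x

theorem noncross {g h : Edge} (hgh : Meet g h → g = h) {s t : ℝ} (hst : s < t)
    (h1 : g.a ≤ s) (h2 : h.a ≤ s) (h3 : t ≤ g.b) (h4 : t ≤ h.b) (hlt : g.y s < h.y s) :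
    g.y t ≤ h.y t := by
  by_contra hc
  push Not at hc
  have hd : 0 < (h.y s - g.y s) + (g.y t - h.y t) := by linarith
  set r := (h.y s - g.y s) / ((h.y s - g.y s) + (g.y t - h.y t)) with hr
  have hr0 : 0 < r := div_pos (by linarith) hd
  have hr1 : r < 1 := by rw [hr, div_lt_one hd]; linarith
  have hreq : r * ((h.y s - g.y s) + (g.y t - h.y t)) = h.y s - g.y s := by
    rw [hr]; field_simp
  have hx1 : s < s + r * (t - s) := by nlinarith
  have hx2 : s + r * (t - s) < t := by nlinarith
  have : g = h := hgh ⟨s + r * (t - s), by linarith, by linarith, by linarith, by linarith, by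
    simp only [Edge.y] at hreq ⊢
    linarith⟩
  rw [this] at hlt
  exact lt_irrefl _ hlt

/-- `e`, `f` are consecutive edges out of a common left endpoint, and `w` is a leftmost vertex
in the closed wedge they span. -/
structure Wedge (E : Finset Edge) (V : Finset (ℝ × ℝ)) (e f : Edge) (w : ℝ × ℝ) : Prop where
  he : e ∈ E
  hf : f ∈ E
  ha : f.a = e.a
  hy : f.y e.a = e.y e.a
  hm : e.m < f.m
  hcons : ∀ g ∈ E, g.a = e.a → g.y e.a = e.y e.a → g.m ≤ e.m ∨ f.m ≤ g.m
  hw : e.a < w.1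
  hwe : w.1 ≤ e.b
  hwf : w.1 ≤ f.b
  hlo : e.y w.1 ≤ w.2
  hhi : w.2 ≤ f.y w.1
  hmin : ∀ v ∈ V, e.a < v.1 → v.1 < w.1 → ¬ (e.y v.1 ≤ v.2 ∧ v.2 ≤ f.y v.1)

theorem wedge_core {E : Finset Edge} {V : Finset (ℝ × ℝ)}
    (hs : ∀ e ∈ E, e.src ∈ V)
    (hx : ∀ e ∈ E, ∀ g ∈ E, Meet e g → e = g) {e f e' f' : Edge} {w : ℝ × ℝ}
    (h : Wedge E V e f w) (h' : Wedge E V e' f' w) (haa : e.a ≤ e'.a) :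
    f.y w.1 ≤ e'.y w.1 ∨ f'.y w.1 ≤ e.y w.1 ∨ (e'.a = e.a ∧ e'.y e.a = e.y e.a) := by
  have key : f.y e'.a < e'.y e'.a ∨ e'.y e'.a < e.y e'.a ∨ (e'.a = e.a ∧ e'.y e.a = e.y e.a) := by
    rcases haa.lt_or_eq with hlt | heq
    · have := h.hmin _ (hs _ h'.he) hlt h'.hw
      simp only [Edge.src] at this
      by_contra hc
      push Not at hc
      exact this ⟨hc.2.1, hc.1⟩
    · rw [← heq, h.hy]
      rcases lt_trichotomy (e'.y e.a) (e.y e.a) with h1 | h1 | h1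
      · exact Or.inr (Or.inl h1)
      · exact Or.inr (Or.inr ⟨rfl, h1⟩)
      · exact Or.inl h1
  rcases key with k | k | k
  · left
    exact noncross (hx _ h.hf _ h'.he) h'.hw (h.ha.le.trans haa) le_rfl h.hwf h'.hwe k
  · right; left
    refine noncross (hx _ h'.hf _ h.he) h'.hw h'.ha.le haa h'.hwf h.hwe ?_
    rw [h'.hy]; exact k
  · right; right; exact k

theorem edge_eq {E : Finset Edge} (hab : ∀ e ∈ E, e.a < e.b)
    (hx : ∀ e ∈ E, ∀ g ∈ E, Meet e g → e = g) {e g : Edge} (he : e ∈ E) (hg : g ∈ E)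
    (ha : g.a = e.a) (hy : g.y e.a = e.y e.a) (hm : g.m = e.m) : e = g := by
  apply hx e he g hg
  have h1 := hab e he
  have h2 := hab g hg
  obtain ⟨x, hx1, hx2⟩ := exists_between (lt_min h1 (ha ▸ h2))
  refine ⟨x, hx1, hx2.trans_le (min_le_left _ _), ha ▸ hx1, hx2.trans_le (min_le_right _ _), ?_⟩
  simp only [Edge.y] at hy ⊢
  rw [hm] at hy ⊢
  linarith

theorem wedge_same {E : Finset Edge} {V : Finset (ℝ × ℝ)} {e f e' f' : Edge} {w : ℝ × ℝ}
    (h : Wedge E V e f w) (h' : Wedge E V e' f' w)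
    (k : e'.a = e.a ∧ e'.y e.a = e.y e.a) (hm : e'.m ≠ e.m) :
    f.y w.1 ≤ e'.y w.1 ∨ f'.y w.1 ≤ e.y w.1 := by
  have k1 := h.hcons e' h'.he k.1 k.2
  have k2 := h'.hcons e h.he k.1.symm (by rw [k.1]; exact k.2.symm)
  have hw := h.hw
  have hy := h.hy
  have hy' := h'.hy
  have k3 := k.2
  rw [k.1] at hy'
  simp only [Edge.y] at *
  rcases k1 with k1 | k1
  · rcases k2 with k2 | k2
    · exact absurd (le_antisymm k1 k2) hm
    · right; nlinarith
  · left; nlinarith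

theorem wedge_unique {E : Finset Edge} {V : Finset (ℝ × ℝ)}
    (hab : ∀ e ∈ E, e.a < e.b) (hs : ∀ e ∈ E, e.src ∈ V)
    (hx : ∀ e ∈ E, ∀ g ∈ E, Meet e g → e = g) {e f e' f' : Edge} {w : ℝ × ℝ}
    (h : Wedge E V e f w) (h' : Wedge E V e' f' w)
    (hh : (e.y w.1 < w.2 ∧ e'.y w.1 < w.2) ∨ (w.2 < f.y w.1 ∧ w.2 < f'.y w.1)) : e = e' := by
  wlog haa : e.a ≤ e'.a generalizing e f e' f'
  · exact (this h' h (by tauto) (le_of_not_ge haa)).symm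
  have l1 := h.hlo
  have l2 := h.hhi
  have l1' := h'.hlo
  have l2' := h'.hhi
  have main : ¬ (f.y w.1 ≤ e'.y w.1 ∨ f'.y w.1 ≤ e.y w.1) := by
    rintro (k | k) <;> rcases hh with hh | hh <;> linarith [hh.1, hh.2]
  rcases wedge_core hs hx h h' haa with k | k | k
  · exact absurd (Or.inl k) main
  · exact absurd (Or.inr k) main
  · by_contra hne
    refine main (wedge_same h h' k ?_)
    intro hm
    exact hne (edge_eq hab hx h.he h'.he k.1 k.2 hm)

theorem wedge_exists {E : Finset Edge} {V : Finset (ℝ × ℝ)}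
    (hab : ∀ e ∈ E, e.a < e.b) (ht : ∀ e ∈ E, e.tgt ∈ V) {e : Edge} (he : e ∈ E)
    (hn : ∃ g ∈ E, g.a = e.a ∧ g.y e.a = e.y e.a ∧ e.m < g.m) :
    ∃ f, ∃ w ∈ V, Wedge E V e f w := by
  classical
  obtain ⟨f, hf, hfm⟩ := Finset.exists_min_image
    (E.filter fun g => g.a = e.a ∧ g.y e.a = e.y e.a ∧ e.m < g.m) (fun g => g.m)
    (by obtain ⟨g, hg, h⟩ := hn; exact ⟨g, by simp [hg, h]⟩)
  simp only [Finset.mem_filter] at hf hfm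
  obtain ⟨hfE, hfa, hfy, hfm'⟩ := hf
  have hord : ∀ x, e.a ≤ x → e.y x ≤ f.y x := by
    intro x hx
    simp only [Edge.y] at *
    nlinarith
  obtain ⟨w, hw, hwm⟩ := Finset.exists_min_image
    (V.filter fun v => e.a < v.1 ∧ v.1 ≤ e.b ∧ v.1 ≤ f.b ∧ e.y v.1 ≤ v.2 ∧ v.2 ≤ f.y v.1)
    (fun v => v.1) (by
      have h1 := hab e he
      have h2 := hab f hfE
      rw [hfa] at h2
      rcases le_total e.b f.b with h | h
      · refine ⟨e.tgt, ?_⟩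
        simp only [Finset.mem_filter]
        exact ⟨ht e he, h1, le_rfl, h, le_rfl, hord _ h1.le⟩
      · refine ⟨f.tgt, ?_⟩
        simp only [Finset.mem_filter]
        exact ⟨ht f hfE, h2, h, le_rfl, hord _ h2.le, le_rfl⟩)
  simp only [Finset.mem_filter] at hw hwm
  obtain ⟨hwV, hw1, hw2, hw3, hw4, hw5⟩ := hw
  refine ⟨f, w, hwV, ⟨he, hfE, hfa, hfy, hfm', ?_, hw1, hw2, hw3, hw4, hw5, ?_⟩⟩
  · intro g hg hga hgy
    by_contra hc
    push Not at hc
    exact absurd (hfm g ⟨hg, hga, hgy, hc.1⟩) (not_le.2 hc.2)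
  · intro v hv hv1 hv2 hv3
    exact absurd (hwm v ⟨hv, hv1, by linarith, by linarith, hv3.1, hv3.2⟩) (not_le.2 hv2)

/-- A noncrossing geometric graph has at most `3 |V|` edges. -/
theorem planar (V : Finset (ℝ × ℝ)) (E : Finset Edge)
    (hab : ∀ e ∈ E, e.a < e.b) (hs : ∀ e ∈ E, e.src ∈ V) (ht : ∀ e ∈ E, e.tgt ∈ V)
    (hx : ∀ e ∈ E, ∀ g ∈ E, Meet e g → e = g) : E.card ≤ 3 * V.card := by
  classical
  have : E.card ≤ ((Finset.univ : Finset (Fin 3)) ×ˢ V).card := by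
    refine card_le_of_rel _ _ (fun e iw =>
      (iw.1 = 0 ∧ iw.2 = e.src ∧ ∀ g ∈ E, g.a = e.a → g.y e.a = e.y e.a → g.m ≤ e.m) ∨
      (iw.1 = 1 ∧ ∃ f, Wedge E V e f iw.2 ∧ e.y iw.2.1 < iw.2.2) ∨
      (iw.1 = 2 ∧ ∃ f, Wedge E V e f iw.2 ∧ iw.2.2 < f.y iw.2.1)) ?_ ?_
    · intro e he
      by_cases hn : ∃ g ∈ E, g.a = e.a ∧ g.y e.a = e.y e.a ∧ e.m < g.m
      · obtain ⟨f, w, hw, h⟩ := wedge_exists hab ht he hn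
        rcases h.hlo.lt_or_eq with h1 | h1
        · exact ⟨(1, w), by simp [hw], Or.inr (Or.inl ⟨rfl, f, h, h1⟩)⟩
        · refine ⟨(2, w), by simp [hw], Or.inr (Or.inr ⟨rfl, f, h, ?_⟩)⟩
          have := h.hm
          have h3 := h.hw
          have h4 := h.hy
          simp only [Edge.y] at *
          nlinarith
      · push Not at hn
        exact ⟨(0, e.src), by simp [hs e he], Or.inl ⟨rfl, rfl, hn⟩⟩
    · rintro e he e' he' ⟨i, w⟩ - h h'
      rcases h with ⟨hi, h⟩ | ⟨hi, f, h, hlt⟩ | ⟨hi, f, h, hlt⟩ <;>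
      rcases h' with ⟨hi', h'⟩ | ⟨hi', f', h', hlt'⟩ | ⟨hi', f', h', hlt'⟩ <;>
      simp only at hi hi' <;> rw [hi] at hi' <;> try (exact absurd hi' (by decide))
      · obtain ⟨h1, h2⟩ := h
        obtain ⟨h1', h2'⟩ := h'
        simp only at h1 h1'
        rw [h1] at h1'
        simp only [Edge.src, Prod.mk.injEq] at h1'
        obtain ⟨p1, p2⟩ := h1'
        rw [← p1] at p2
        refine edge_eq hab hx he he' p1.symm p2.symm (le_antisymm (h2 e' he' p1.symm p2.symm) ?_)
        exact h2' e he p1 (by rw [← p1]; exact p2)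
      · exact wedge_unique hab hs hx h h' (Or.inl ⟨hlt, hlt'⟩)
      · exact wedge_unique hab hs hx h h' (Or.inr ⟨hlt, hlt'⟩)
  simpa using this

theorem wsum {α : Type*} [DecidableEq α] (V T : Finset α) (hT : T ⊆ V) (p : ℝ) :
    ∑ S ∈ V.powerset, (p ^ S.card * (1 - p) ^ (V \ S).card) * (if T ⊆ S then 1 else 0)
      = p ^ T.card := by
  have h := Finset.prod_add (fun _ : α => p) (fun i => if i ∈ T then 0 else 1 - p) V
  have h1 : ∏ i ∈ V, (p + if i ∈ T then 0 else 1 - p) = p ^ T.card := by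
    rw [← Finset.prod_subset hT]
    · rw [← Finset.prod_const]
      exact Finset.prod_congr rfl fun i hi => by simp [hi]
    · intro i _ hi
      simp [hi]
  rw [← h1, h]
  refine Finset.sum_congr rfl fun S hS => ?_
  rw [Finset.prod_const, mul_assoc]
  congr 1
  split_ifs with hTS
  · rw [mul_one, ← Finset.prod_const]
    refine Finset.prod_congr rfl fun i hi => ?_
    rw [if_neg]
    exact fun hiT => (Finset.mem_sdiff.1 hi).2 (hTS hiT)
  · obtain ⟨i, hi, hiS⟩ := Finset.not_subset.1 hTS
    rw [mul_zero, Finset.prod_eq_zero (Finset.mem_sdiff.2 ⟨hT hi, hiS⟩)]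
    simp [hi]

theorem wsum_card {α β : Type*} [DecidableEq α] (V : Finset α) (E : Finset β) (T : β → Finset α)
    (k : ℕ) (hT : ∀ e ∈ E, T e ⊆ V) (hk : ∀ e ∈ E, (T e).card = k) (p : ℝ) :
    ∑ S ∈ V.powerset, (p ^ S.card * (1 - p) ^ (V \ S).card) *
      ((E.filter fun e => T e ⊆ S).card : ℝ) = E.card * p ^ k := by
  have : ∀ S ∈ V.powerset, (p ^ S.card * (1 - p) ^ (V \ S).card) *
      ((E.filter fun e => T e ⊆ S).card : ℝ) =
      ∑ e ∈ E, (p ^ S.card * (1 - p) ^ (V \ S).card) * (if T e ⊆ S then 1 else 0) := by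
    intro S _
    rw [← Finset.mul_sum]
    congr 1
    simp
  rw [Finset.sum_congr rfl this, Finset.sum_comm,
    Finset.sum_congr rfl (fun e he => by rw [wsum V (T e) (hT e he) p, hk e he])]
  simp

theorem amplify {α β γ : Type*} [DecidableEq α] (V : Finset α) (E : Finset β) (X : Finset γ)
    (TE : β → Finset α) (TX : γ → Finset α)
    (hE : ∀ e ∈ E, TE e ⊆ V) (hE2 : ∀ e ∈ E, (TE e).card = 2)
    (hX : ∀ e ∈ X, TX e ⊆ V) (hX4 : ∀ e ∈ X, (TX e).card = 4)
    (h : ∀ S ⊆ V, (E.filter fun e => TE e ⊆ S).card ≤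
      3 * S.card + (X.filter fun e => TX e ⊆ S).card)
    (p : ℝ) (hp : 0 ≤ p) (hp1 : p ≤ 1) :
    E.card * p ^ 2 ≤ 3 * (V.card * p) + X.card * p ^ 4 := by
  rw [← wsum_card V E TE 2 hE hE2 p, ← wsum_card V X TX 4 hX hX4 p]
  have hV := wsum_card V V (fun v => {v}) 1 (fun v hv => by simpa using hv) (by simp) p
  rw [pow_one] at hV
  rw [← hV, Finset.mul_sum, ← Finset.sum_add_distrib]
  refine Finset.sum_le_sum fun S hS => ?_
  have hSV := Finset.mem_powerset.1 hS
  have h1 : (V.filter fun v => ({v} : Finset α) ⊆ S) = S := by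
    ext v
    simp only [Finset.mem_filter, Finset.singleton_subset_iff]
    exact ⟨fun h => h.2, fun h => ⟨hSV h, h⟩⟩
  rw [h1]
  have h2 : ((E.filter fun e => TE e ⊆ S).card : ℝ) ≤
      3 * S.card + (X.filter fun e => TX e ⊆ S).card := by exact_mod_cast h S hSV
  have hw : 0 ≤ p ^ S.card * (1 - p) ^ (V \ S).card :=
    mul_nonneg (pow_nonneg hp _) (pow_nonneg (by linarith) _)
  nlinarith [mul_le_mul_of_nonneg_left h2 hw]

/-- Bound for nonvertical lines, written as `(m, c)`. -/
theorem cubic (P : Finset (ℝ × ℝ)) (L : Finset (ℝ × ℝ)) :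
    ∃ N : ℕ, (∀ p : ℝ, 0 ≤ p → p ≤ 1 → N * p ^ 2 ≤ 3 * (P.card * p) + (L.card : ℝ) ^ 2 * p ^ 4) ∧
      ∀ I : Finset ((ℝ × ℝ) × ℝ × ℝ),
        (∀ i ∈ I, i.1 ∈ P ∧ i.2 ∈ L ∧ i.1.2 = i.2.1 * i.1.1 + i.2.2) → I.card ≤ N + L.card := by
  classical
  obtain ⟨E, hE⟩ : ∃ E : Finset Edge, ∀ e, e ∈ E ↔ ((e.m, e.c) ∈ L ∧ e.src ∈ P ∧ e.tgt ∈ P ∧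
      e.a < e.b ∧ ∀ q ∈ P, e.a < q.1 → q.1 < e.b → q.2 ≠ e.y q.1) := by
    refine ⟨((L ×ˢ P ×ˢ P).image fun t => (⟨t.1.1, t.1.2, t.2.1.1, t.2.2.1⟩ : Edge)).filter
      fun e => ((e.m, e.c) ∈ L ∧ e.src ∈ P ∧ e.tgt ∈ P ∧
      e.a < e.b ∧ ∀ q ∈ P, e.a < q.1 → q.1 < e.b → q.2 ≠ e.y q.1), fun e => ?_⟩
    rw [Finset.mem_filter]
    refine ⟨fun h => h.2, fun h => ⟨?_, h⟩⟩
    rw [Finset.mem_image]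
    exact ⟨((e.m, e.c), e.src, e.tgt), by simp [h.1, h.2.1, h.2.2.1], rfl⟩
  have same : ∀ e ∈ E, ∀ g ∈ E, e.m = g.m → e.c = g.c → Meet e g → e = g := by
    rintro e he g hg hm hc ⟨x, h1, h2, h3, h4, -⟩
    obtain ⟨-, es, et, -, e5⟩ := (hE e).1 he
    obtain ⟨-, gs, gt, -, g5⟩ := (hE g).1 hg
    have hy : ∀ x, e.y x = g.y x := by intro x; simp [Edge.y, hm, hc]
    have a1 : e.a ≤ g.a := by
      by_contra h; push Not at h
      exact g5 _ es h (h1.trans h4) (hy _)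
    have a2 : g.a ≤ e.a := by
      by_contra h; push Not at h
      exact e5 _ gs h (h3.trans h2) (hy _).symm
    have b1 : e.b ≤ g.b := by
      by_contra h; push Not at h
      exact e5 _ gt (h1.trans h4) h (hy _).symm
    have b2 : g.b ≤ e.b := by
      by_contra h; push Not at h
      exact g5 _ et (h3.trans h2) h (hy _)
    exact Edge.ext hm hc (le_antisymm a1 a2) (le_antisymm b1 b2)
  -- two distinct abscissae with the same height force equal lines
  have two : ∀ e g : Edge, ∀ x x', x ≠ x' → e.y x = g.y x → e.y x' = g.y x' →
      e.m = g.m ∧ e.c = g.c := by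
    intro e g x x' hne h1 h2
    simp only [Edge.y] at h1 h2
    have : (e.m - g.m) * (x - x') = 0 := by linarith
    have hm : e.m = g.m := by
      rcases mul_eq_zero.1 this with h | h
      · linarith
      · exact absurd (by linarith) hne
    refine ⟨hm, ?_⟩
    rw [hm] at h1
    linarith
  obtain ⟨X, hX⟩ : ∃ X : Finset (Edge × Edge), ∀ t, t ∈ X ↔
      (t.1 ∈ E ∧ t.2 ∈ E ∧ Meet t.1 t.2 ∧ t.1 ≠ t.2) :=
    ⟨(E ×ˢ E).filter fun t => Meet t.1 t.2 ∧ t.1 ≠ t.2, fun t => by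
      simp only [Finset.mem_filter, Finset.mem_product, and_assoc]⟩
  have hXL : X.card ≤ (L ×ˢ L).card := by
    refine card_le_of_rel _ _ (fun t l => (t.1.m, t.1.c) = l.1 ∧ (t.2.m, t.2.c) = l.2) ?_ ?_
    · intro t ht
      obtain ⟨h1, h2, -⟩ := (hX t).1 ht
      exact ⟨((t.1.m, t.1.c), (t.2.m, t.2.c)),
        Finset.mem_product.2 ⟨((hE _).1 h1).1, ((hE _).1 h2).1⟩, rfl, rfl⟩
    · rintro ⟨e, g⟩ ht ⟨e', g'⟩ ht' ⟨l1, l2⟩ - ⟨h1, h2⟩ ⟨h1', h2'⟩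
      obtain ⟨he, hg, ⟨x, x1, x2, x3, x4, x5⟩, hne⟩ := (hX _).1 ht
      obtain ⟨he', hg', ⟨x', x1', x2', x3', x4', x5'⟩, hne'⟩ := (hX _).1 ht'
      simp only at *
      rw [← h1', Prod.mk.injEq] at h1
      rw [← h2', Prod.mk.injEq] at h2
      have hye : ∀ z, e.y z = e'.y z := fun z => by simp [Edge.y, h1.1, h1.2]
      have hyg : ∀ z, g.y z = g'.y z := fun z => by simp [Edge.y, h2.1, h2.2]
      have hxx : x = x' := by
        by_contra hxx
        have := two e g x x' hxx x5 (by rw [hye, hyg]; exact x5')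
        exact hne (same e he g hg this.1 this.2 ⟨x, x1, x2, x3, x4, x5⟩)
      subst hxx
      rw [same e he e' he' h1.1 h1.2 ⟨x, x1, x2, x1', x2', hye x⟩,
        same g hg g' hg' h2.1 h2.2 ⟨x, x3, x4, x3', x4', hyg x⟩]
  refine ⟨E.card, ?_, ?_⟩
  · intro p hp hp1
    have := amplify P E X (fun e => {e.src, e.tgt}) (fun t => {t.1.src, t.1.tgt, t.2.src, t.2.tgt})
      ?_ ?_ ?_ ?_ ?_ p hp hp1
    · have h2 : (X.card : ℝ) ≤ (L.card : ℝ) ^ 2 := by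
        rw [Finset.card_product] at hXL
        rw [sq]; exact_mod_cast hXL
      have h4 : 0 ≤ p ^ 4 := by positivity
      nlinarith [mul_le_mul_of_nonneg_right h2 h4]
    · intro e he
      obtain ⟨-, h1, h2, -⟩ := (hE e).1 he
      simp [Finset.insert_subset_iff, h1, h2]
    · intro e he
      obtain ⟨-, -, -, h1, -⟩ := (hE e).1 he
      rw [Finset.card_pair]
      intro h
      simp only [Edge.src, Edge.tgt, Prod.mk.injEq] at h
      linarith [h.1]
    · intro t ht
      obtain ⟨he, hg, -⟩ := (hX t).1 ht
      obtain ⟨-, h1, h2, -⟩ := (hE _).1 he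
      obtain ⟨-, h3, h4, -⟩ := (hE _).1 hg
      simp [Finset.insert_subset_iff, h1, h2, h3, h4]
    · rintro ⟨e, g⟩ ht
      obtain ⟨he, hg, hmeet, hne⟩ := (hX _).1 ht
      obtain ⟨x, x1, x2, x3, x4, x5⟩ := id hmeet
      simp only at *
      have key : ∀ z, z ≠ x → e.y z ≠ g.y z := by
        intro z hz h
        have := two e g z x hz h x5
        exact hne (same e he g hg this.1 this.2 hmeet)
      have n1 : e.src ≠ e.tgt := by
        intro h; simp only [Edge.src, Edge.tgt, Prod.mk.injEq] at h; linarith [h.1]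
      have n2 : e.src ≠ g.src := by
        intro h; simp only [Edge.src, Prod.mk.injEq] at h
        exact key e.a x1.ne (by rw [h.2, h.1])
      have n3 : e.src ≠ g.tgt := by
        intro h; simp only [Edge.src, Edge.tgt, Prod.mk.injEq] at h; linarith [h.1]
      have n4 : e.tgt ≠ g.src := by
        intro h; simp only [Edge.src, Edge.tgt, Prod.mk.injEq] at h; linarith [h.1]
      have n5 : e.tgt ≠ g.tgt := by
        intro h; simp only [Edge.tgt, Prod.mk.injEq] at h
        exact key e.b x2.ne' (by rw [h.2, h.1])
      have n6 : g.src ≠ g.tgt := by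
        intro h; simp only [Edge.src, Edge.tgt, Prod.mk.injEq] at h; linarith [h.1]
      rw [Finset.card_insert_of_notMem (by simp [n1, n2, n3]),
        Finset.card_insert_of_notMem (by simp [n4, n5]), Finset.card_pair n6]
    · intro S hS
      set F := E.filter fun e => ({e.src, e.tgt} : Finset (ℝ × ℝ)) ⊆ S with hF
      have hFm : ∀ e, e ∈ F ↔ e ∈ E ∧ e.src ∈ S ∧ e.tgt ∈ S := by
        intro e; simp [hF, Finset.insert_subset_iff]
      rw [← Finset.card_filter_add_card_filter_not (s := F) (fun e => ∀ g ∈ F, Meet e g → e = g)]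
      refine add_le_add ?_ ?_
      · apply planar
        · intro e he
          exact ((hE e).1 ((hFm e).1 (Finset.mem_filter.1 he).1).1).2.2.2.1
        · intro e he
          exact ((hFm e).1 (Finset.mem_filter.1 he).1).2.1
        · intro e he
          exact ((hFm e).1 (Finset.mem_filter.1 he).1).2.2
        · intro e he g hg
          exact (Finset.mem_filter.1 he).2 g (Finset.mem_filter.1 hg).1
      · refine card_le_of_rel _ _ (fun e t => t.1 = e) ?_ ?_
        · intro e he
          obtain ⟨he, h⟩ := Finset.mem_filter.1 he
          push Not at h
          obtain ⟨g, hg, h1, h2⟩ := h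
          obtain ⟨e1, e2, e3⟩ := (hFm e).1 he
          obtain ⟨g1, g2, g3⟩ := (hFm g).1 hg
          refine ⟨(e, g), ?_, rfl⟩
          rw [Finset.mem_filter, hX]
          exact ⟨⟨e1, g1, h1, h2⟩, by simp [Finset.insert_subset_iff, e2, e3, g2, g3]⟩
        · intro a _ a' _ b _ h h'
          exact h.symm.trans h'
  · intro I hI
    have : I.card ≤ (E.disjSum L).card := by
      refine card_le_of_rel _ _ (fun i s =>
        (∃ e : Edge, s = Sum.inl e ∧ e.src = i.1 ∧ (e.m, e.c) = i.2) ∨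
        (s = Sum.inr i.2 ∧ ∀ q ∈ P, q.2 = i.2.1 * q.1 + i.2.2 → q.1 ≤ i.1.1)) ?_ ?_
      · intro i hi
        obtain ⟨h1, h2, h3⟩ := hI i hi
        by_cases hl : ∀ q ∈ P, q.2 = i.2.1 * q.1 + i.2.2 → q.1 ≤ i.1.1
        · exact ⟨Sum.inr i.2, Finset.inr_mem_disjSum.2 h2, Or.inr ⟨rfl, hl⟩⟩
        · push Not at hl
          obtain ⟨q0, hq0, hq0', hq0''⟩ := hl
          obtain ⟨q, hq, hqm⟩ := Finset.exists_min_image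
            (P.filter fun q => q.2 = i.2.1 * q.1 + i.2.2 ∧ i.1.1 < q.1) (fun q => q.1)
            ⟨q0, by simp only [Finset.mem_filter]; exact ⟨hq0, hq0', hq0''⟩⟩
          simp only [Finset.mem_filter] at hq hqm
          have hsrc : (⟨i.2.1, i.2.2, i.1.1, q.1⟩ : Edge).src = i.1 :=
            Prod.ext rfl h3.symm
          have htgt : (⟨i.2.1, i.2.2, i.1.1, q.1⟩ : Edge).tgt = q :=
            Prod.ext rfl hq.2.1.symm
          refine ⟨Sum.inl ⟨i.2.1, i.2.2, i.1.1, q.1⟩, ?_, Or.inl ⟨_, rfl, hsrc, rfl⟩⟩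
          rw [Finset.inl_mem_disjSum, hE, hsrc, htgt]
          refine ⟨h2, h1, hq.1, hq.2.2, ?_⟩
          intro r hr hr1 hr2 hr3
          exact absurd (hqm r ⟨hr, hr3, hr1⟩) (not_le.2 hr2)
      · rintro ⟨q, l⟩ hi ⟨q', l'⟩ hi' s - h h'
        obtain ⟨h1, h2, h3⟩ := hI _ hi
        obtain ⟨h1', h2', h3'⟩ := hI _ hi'
        rcases h with ⟨e, he, hs, hm⟩ | ⟨hs, hm⟩ <;> rcases h' with ⟨e', he', hs', hm'⟩ | ⟨hs', hm'⟩
        · rw [he, Sum.inl.injEq] at he'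
          subst he'
          simp only at *
          rw [← hs, ← hm, ← hs', ← hm']
        · rw [he] at hs'; exact absurd hs' (by simp)
        · rw [hs] at he'; exact absurd he' (by simp)
        · rw [hs, Sum.inr.injEq] at hs'
          simp only at *
          subst hs'
          have : q.1 = q'.1 := le_antisymm (hm' q h1 h3) (hm q' h1' h3')
          have h5 : q.2 = q'.2 := by rw [h3, h3', this]
          rw [Prod.ext this h5]
    rwa [Finset.card_disjSum] at this

theorem arith (N V L : ℝ) (hN : 0 ≤ N) (hV : 0 ≤ V) (hL : 0 ≤ L)
    (h : ∀ p : ℝ, 0 ≤ p → p ≤ 1 → N * p ^ 2 ≤ 3 * (V * p) + L ^ 2 * p ^ 4) :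
    N ≤ 6 * ((V * L) ^ ((2 : ℝ) / 3) + V) := by
  have hpow : 0 ≤ (V * L) ^ ((2 : ℝ) / 3) := Real.rpow_nonneg (mul_nonneg hV hL) _
  rcases le_or_gt N (6 * V) with h6 | h6
  · linarith
  have hN0 : 0 < N := by linarith
  rcases hV.eq_or_lt with hV0 | hV0
  · -- no vertices: let p tend to zero
    exfalso
    subst hV0
    have hq : 0 < N / (N + L ^ 2 + 1) := by positivity
    have hq1 : N / (N + L ^ 2 + 1) ≤ 1 := by
      rw [div_le_one (by positivity)]; nlinarith
    set q := N / (N + L ^ 2 + 1) with hqd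
    have hh := h q hq.le hq1
    have hqq : q * (N + L ^ 2 + 1) = N := by rw [hqd]; field_simp
    have h2 : N ≤ L ^ 2 * q ^ 2 := by
      have : 0 < q ^ 2 := by positivity
      nlinarith
    have h3 : L ^ 2 * q ^ 2 ≤ L ^ 2 * q := by
      apply mul_le_mul_of_nonneg_left _ (by positivity); nlinarith
    nlinarith
  set p := 6 * V / N with hp
  have hp0 : 0 < p := by positivity
  have hp1 : p ≤ 1 := by rw [hp, div_le_one hN0]; linarith
  have hpN : p * N = 6 * V := by rw [hp]; field_simp
  have hh := h p hp0.le hp1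
  have h1 : N * p ≤ 3 * V + L ^ 2 * p ^ 3 := by
    by_contra hc
    push Not at hc
    nlinarith
  have h2 : 3 * V ≤ L ^ 2 * p ^ 3 := by linarith
  have h3 : 3 * V * N ^ 3 ≤ L ^ 2 * (216 * V ^ 3) := by
    have := mul_le_mul_of_nonneg_right h2 (pow_nonneg hN 3)
    have e : L ^ 2 * p ^ 3 * N ^ 3 = L ^ 2 * (p * N) ^ 3 := by ring
    rw [e, hpN] at this
    nlinarith
  have h4 : N ^ 3 ≤ 72 * (V * L) ^ 2 := by
    have : V * N ^ 3 ≤ V * (72 * (V * L) ^ 2) := by nlinarith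
    exact le_of_mul_le_mul_left this hV0
  have hc3 : ((V * L) ^ ((2 : ℝ) / 3)) ^ 3 = (V * L) ^ 2 := by
    rw [← Real.rpow_natCast, ← Real.rpow_mul (mul_nonneg hV hL), ← Real.rpow_natCast]
    norm_num
  have h5 : N ^ 3 ≤ (6 * (V * L) ^ ((2 : ℝ) / 3)) ^ 3 := by
    rw [mul_pow, hc3]
    nlinarith [sq_nonneg (V * L)]
  have h6 := le_of_pow_le_pow_left₀ (by norm_num) (by positivity) h5
  linarith

end ST

open Classical in
theorem szemeredi_trotter :
    ∃ C : ℝ, 0 < C ∧ ∀ (P : Finset (ℝ × ℝ)) (L : Finset (ℝ × ℝ × ℝ)),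
      (∀ l ∈ L, (l.1, l.2.1) ≠ (0, 0)) →
      (∀ l ∈ L, ∀ l' ∈ L, ({p : ℝ × ℝ | OnLine p l} = {p : ℝ × ℝ | OnLine p l'}) → l = l') →
      (((P ×ˢ L).filter fun pl : (ℝ × ℝ) × ℝ × ℝ × ℝ => OnLine pl.1 pl.2).card : ℝ) ≤
        C * (((P.card : ℝ) * L.card) ^ ((2 : ℝ) / 3) + P.card + L.card) := by
  refine ⟨7, by norm_num, fun P L hL hinj => ?_⟩
  set I := (P ×ˢ L).filter fun pl : (ℝ × ℝ) × ℝ × ℝ × ℝ => OnLine pl.1 pl.2 with hI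
  have hIm : ∀ i, i ∈ I ↔ i.1 ∈ P ∧ i.2 ∈ L ∧ OnLine i.1 i.2 := by
    intro i; simp [hI, and_assoc]
  have hsplit := Finset.card_filter_add_card_filter_not (s := I) (fun i => i.2.2.1 = 0)
  have hvert : (I.filter fun i => i.2.2.1 = 0).card ≤ P.card := by
    refine Finset.card_le_card_of_injOn (fun i => i.1) ?_ ?_
    · intro i hi
      exact ((hIm i).1 (Finset.mem_filter.1 hi).1).1
    · rintro ⟨q, a, b, c⟩ hi ⟨q', a', b', c'⟩ hi' hq
      obtain ⟨h1, hb⟩ := Finset.mem_filter.1 hi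
      obtain ⟨h1', hb'⟩ := Finset.mem_filter.1 hi'
      obtain ⟨-, hl, ho⟩ := (hIm _).1 h1
      obtain ⟨-, hl', ho'⟩ := (hIm _).1 h1'
      simp only [OnLine] at hq hb hb' ho ho'
      subst hq hb hb'
      have ha : a ≠ 0 := fun h => hL _ hl (by simp [h])
      have ha' : a' ≠ 0 := fun h => hL _ hl' (by simp [h])
      refine Prod.ext rfl (hinj _ hl _ hl' ?_)
      ext r
      simp only [OnLine, Set.mem_ofPred_eq, ← ho, ← ho', zero_mul, add_zero]
      rw [mul_right_inj' ha, mul_right_inj' ha']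
  set φ : ℝ × ℝ × ℝ → ℝ × ℝ := fun l => (- l.1 / l.2.1, l.2.2 / l.2.1) with hφ
  have hon : ∀ (q : ℝ × ℝ) (l : ℝ × ℝ × ℝ), l.2.1 ≠ 0 →
      (OnLine q l ↔ q.2 = (φ l).1 * q.1 + (φ l).2) := by
    intro q l hb
    simp only [OnLine, hφ]
    constructor
    · intro h
      field_simp
      linarith
    · intro h
      rw [h]
      field_simp
      ring
  set L' := (L.filter fun l => l.2.1 ≠ 0).image φ with hL'
  have hL'c : L'.card ≤ L.card := Finset.card_image_le.trans (Finset.card_filter_le _ _)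
  obtain ⟨N, hN1, hN2⟩ := ST.cubic P L'
  have hnon : (I.filter fun i => ¬ i.2.2.1 = 0).card ≤ N + L'.card := by
    rw [← Finset.card_image_of_injOn (s := I.filter fun i => ¬ i.2.2.1 = 0)
      (f := fun i => (i.1, φ i.2))]
    · apply hN2
      intro j hj
      obtain ⟨i, hi, rfl⟩ := Finset.mem_image.1 hj
      obtain ⟨h1, hb⟩ := Finset.mem_filter.1 hi
      obtain ⟨hp, hl, ho⟩ := (hIm _).1 h1
      exact ⟨hp, Finset.mem_image_of_mem _ (Finset.mem_filter.2 ⟨hl, hb⟩), (hon _ _ hb).1 ho⟩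
    · rintro ⟨q, l⟩ hi ⟨q', l'⟩ hi' hq
      obtain ⟨h1, hb⟩ := Finset.mem_filter.1 hi
      obtain ⟨h1', hb'⟩ := Finset.mem_filter.1 hi'
      obtain ⟨-, hl, -⟩ := (hIm _).1 h1
      obtain ⟨-, hl', -⟩ := (hIm _).1 h1'
      obtain ⟨e1, e2⟩ := Prod.mk.inj hq
      simp only at hb hb' hl hl' e1 e2
      rw [e1, hinj l hl l' hl']
      ext r
      simp only [Set.mem_ofPred_eq]
      rw [hon r l hb, hon r l' hb', e2]
  have hA := ST.arith N P.card L'.card (by positivity) (by positivity) (by positivity) hN1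
  have hmono : ((P.card : ℝ) * L'.card) ^ ((2 : ℝ) / 3) ≤ ((P.card : ℝ) * L.card) ^ ((2 : ℝ) / 3) := by
    apply Real.rpow_le_rpow (by positivity) _ (by norm_num)
    exact mul_le_mul_of_nonneg_left (by exact_mod_cast hL'c) (by positivity)
  have hpos : 0 ≤ ((P.card : ℝ) * L.card) ^ ((2 : ℝ) / 3) := by positivity
  have hfin : (I.card : ℝ) ≤ P.card + (N + L.card) := by
    exact_mod_cast (by omega : I.card ≤ P.card + (N + L.card))
  have hL0 : (0 : ℝ) ≤ L.card := by positivity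
  linarith
end
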